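/- Assume GRH. Let Φ: ℝ → ℝ be a fixed smooth compactly supported function with support contained in (0,∞), and fix δ > 0 and ε > 0. Then there exist constants C > 0 and x₀ such that for all x ≥ x₀, all y with (log x)^{2+δ} ≤ y ≤ exp((log x)^{1/2−δ}), every positive integer q₀ all of whose prime factors are at most y, and every real γ with x^{δ−1} ≤ |γ| ≤ 1/(q₀√x), one has |M(x,y;q₀,γ)| ≤ C·x^{3/4+ε}·q₀^{−3/4+ε}. -/

import Mathlib

noncomputable section

/-- The Generalized Riemann Hypothesis. -/
def GRH : Prop :=
  (∀ s : ℂ, 0 < s.re → s.re < 1 → riemannZeta s = 0 → s.re = 1 / 2) ∧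
  (∀ (N : ℕ) [NeZero N] (χ : DirichletCharacter ℂ N) (s : ℂ),
    0 < s.re → s.re < 1 → DirichletCharacter.LFunction χ s = 0 → s.re = 1 / 2)

/-- The local main term `M(x,y;q,γ)`. -/
def Mterm (x y : ℝ) (Φ : ℝ → ℝ) (q : ℕ) (γ : ℝ) : ℂ :=
  ∑' n : {n : ℕ // 0 < n ∧ ∀ p : ℕ, p.Prime → p ∣ n → (p : ℝ) ≤ y},
    (((ArithmeticFunction.moebius (q / Nat.gcd q (n : ℕ)) : ℝ) /
        (Nat.totient (q / Nat.gcd q (n : ℕ)) : ℝ) : ℝ) : ℂ) *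
      Complex.exp (2 * (Real.pi : ℂ) * Complex.I * ((n : ℕ) : ℂ) * (γ : ℂ)) *
      ((Φ (((n : ℕ) : ℝ) / x) : ℝ) : ℂ)

open MeasureTheory Set Filter Topology

/-- The fractional part on `(1, ∞)`, extended by zero. -/
def fractTail (v : ℝ) : ℂ := (Ioi (1 : ℝ)).indicator (fun v => ((Int.fract v : ℝ) : ℂ)) v

theorem norm_fractTail_le (v : ℝ) : ‖fractTail v‖ ≤ 1 := by
  unfold fractTail
  by_cases h : v ∈ Ioi (1 : ℝ)
  · rw [indicator_of_mem h, Complex.norm_real, Real.norm_eq_abs, abs_of_nonneg (Int.fract_nonneg v)]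
    exact (Int.fract_lt_one v).le
  · rw [indicator_of_notMem h]; simp

theorem measurable_fractTail : Measurable fractTail :=
  Measurable.indicator (Complex.measurable_ofReal.comp measurable_fract) measurableSet_Ioi

theorem mellin_fractTail_neg (s : ℂ) :
    mellin fractTail (-s) =
      ∫ t in Ioi (1 : ℝ), ((Int.fract t : ℝ) : ℂ) * (t : ℂ) ^ (-(s + 1)) := by
  unfold mellin
  have : (fun t : ℝ => (t : ℂ) ^ (-s - 1) • fractTail t) =
      (Ioi (1 : ℝ)).indicator (fun t => ((Int.fract t : ℝ) : ℂ) * (t : ℂ) ^ (-(s + 1))) := by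
    funext t
    unfold fractTail
    by_cases h : t ∈ Ioi (1 : ℝ)
    · rw [indicator_of_mem h, indicator_of_mem h, smul_eq_mul, mul_comm]
      congr 2; ring
    · rw [indicator_of_notMem h, indicator_of_notMem h]; simp
  rw [this, setIntegral_indicator measurableSet_Ioi]
  congr 2
  ext t; simp only [mem_inter_iff, mem_Ioi]; constructor
  · exact fun h => h.2
  · exact fun h => ⟨lt_trans one_pos h, h⟩

theorem differentiableAt_mellin_fractTail {s : ℂ} (hs : s.re < 0) :
    DifferentiableAt ℂ (mellin fractTail) s := by
  apply mellin_differentiableAt_of_isBigO_rpow (a := 0) (b := s.re - 1)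
  · apply LocallyIntegrable.locallyIntegrableOn
    rw [locallyIntegrable_iff]
    intro k hk
    exact Measure.integrableOn_of_bounded (M := 1) hk.measure_lt_top.ne
      measurable_fractTail.aestronglyMeasurable (ae_of_all _ norm_fractTail_le)
  · simp only [neg_zero, Real.rpow_zero]
    exact Asymptotics.IsBigO.of_bound 1 (Eventually.of_forall fun v => by
      simpa using norm_fractTail_le v)
  · exact hs
  · apply Asymptotics.IsBigO.of_bound 1
    filter_upwards [Ioo_mem_nhdsGT (show (0:ℝ) < 1 by norm_num)] with v hv
    have : fractTail v = 0 := by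
      unfold fractTail; rw [indicator_of_notMem]; simpa using hv.2.le
    rw [this]; simp only [norm_zero]; positivity
  · linarith

theorem norm_mellin_fractTail_neg_le {s : ℂ} (hs : 0 < s.re) :
    ‖mellin fractTail (-s)‖ ≤ 1 / s.re := by
  rw [mellin_fractTail_neg]
  have h1 : ∫ t in Ioi (1 : ℝ), t ^ (-s.re - 1) = 1 / s.re := by
    rw [integral_Ioi_rpow_of_lt (by linarith) one_pos]
    simp
  rw [← h1]
  apply norm_integral_le_of_norm_le (integrableOn_Ioi_rpow_of_lt (by linarith) one_pos)
  rw [ae_restrict_iff' measurableSet_Ioi]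
  refine ae_of_all _ fun t ht => ?_
  have ht0 : (0:ℝ) < t := lt_trans one_pos ht
  rw [norm_mul, Complex.norm_cpow_eq_rpow_re_of_pos ht0, Complex.norm_real, Real.norm_eq_abs,
    abs_of_nonneg (Int.fract_nonneg t)]
  have : (-(s+1)).re = -s.re - 1 := by simp; ring
  rw [this]
  have := Real.rpow_nonneg ht0.le (-s.re - 1)
  nlinarith [Int.fract_lt_one t]

theorem riemannZeta₀_eq_of_one_lt_re {s : ℂ} (hs : 1 < s.re) :
    riemannZeta₀ s = 1 - s * mellin fractTail (-s) := by
  have hs1 : s ≠ 1 := by rintro rfl; simp at hs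
  have hs1' : s - 1 ≠ 0 := sub_ne_zero.2 hs1
  have hz := LSeries_eq_mul_integral' (1 : ℕ → ℂ) (r := 1) zero_le_one hs (by
    apply Asymptotics.IsBigO.of_bound 1
    filter_upwards with n
    simp)
  rw [LSeries_one_eq_riemannZeta hs, riemannZeta_eq_inv_sub_add hs1] at hz
  have h2 : ∫ t in Ioi (1 : ℝ), (t : ℂ) ^ (-s) = 1 / (s - 1) := by
    rw [integral_Ioi_cpow_of_lt (by simpa using hs) one_pos]
    simp only [Complex.ofReal_one, Complex.one_cpow]
    rw [show -s + 1 = -(s - 1) by ring]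
    field_simp
  have i1 : IntegrableOn (fun t : ℝ => (t : ℂ) ^ (-s)) (Ioi 1) :=
    integrableOn_Ioi_cpow_of_lt (by simpa using hs) one_pos
  have i2 : IntegrableOn (fun t : ℝ => ((Int.fract t : ℝ) : ℂ) * (t : ℂ) ^ (-(s + 1))) (Ioi 1) := by
    refine Integrable.bdd_mul (c := 1)
      (integrableOn_Ioi_cpow_of_lt (by simp; linarith) one_pos) ?_ ?_
    · exact (Complex.measurable_ofReal.comp measurable_fract).aestronglyMeasurable
    · refine ae_of_all _ fun t => ?_
      rw [Complex.norm_real, Real.norm_eq_abs, abs_of_nonneg (Int.fract_nonneg t)]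
      exact (Int.fract_lt_one t).le
  have h3 : ∫ t in Ioi (1 : ℝ), (∑ k ∈ Finset.Icc 1 ⌊t⌋₊, (1 : ℕ → ℂ) k) * (t : ℂ) ^ (-(s + 1)) =
      1 / (s - 1) - mellin fractTail (-s) := by
    rw [mellin_fractTail_neg, ← h2, ← integral_sub i1 i2]
    apply setIntegral_congr_fun measurableSet_Ioi
    intro t ht
    have ht0 : (0:ℝ) < t := lt_trans one_pos ht
    have hfl : ((⌊t⌋₊ : ℝ)) = t - Int.fract t := by
      rw [Int.self_sub_fract]
      rw [natCast_floor_eq_intCast_floor ht0.le]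
    simp only [Pi.one_apply, Finset.sum_const, Nat.card_Icc, add_tsub_cancel_right, nsmul_eq_mul,
      mul_one]
    have : ((⌊t⌋₊ : ℂ)) = (t : ℂ) - ((Int.fract t : ℝ) : ℂ) := by exact_mod_cast congrArg (Complex.ofReal) hfl
    rw [this, sub_mul]
    congr 1
    rw [show -s = 1 + -(s+1) by ring, Complex.cpow_add _ _ (by exact_mod_cast ht0.ne'),
      Complex.cpow_one]
  rw [h3] at hz
  have : riemannZeta₀ s = s * (1 / (s - 1) - mellin fractTail (-s)) - (s - 1)⁻¹ := by
    rw [← hz]; ring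
  rw [this]; field_simp; ring

theorem riemannZeta₀_eq {s : ℂ} (hs : 0 < s.re) :
    riemannZeta₀ s = 1 - s * mellin fractTail (-s) := by
  have hopen : IsOpen {s : ℂ | 0 < s.re} := isOpen_lt continuous_const Complex.continuous_re
  have hf : AnalyticOnNhd ℂ riemannZeta₀ {s : ℂ | 0 < s.re} :=
    differentiable_riemannZeta₀.differentiableOn.analyticOnNhd hopen
  have hg : AnalyticOnNhd ℂ (fun s => 1 - s * mellin fractTail (-s)) {s : ℂ | 0 < s.re} := by
    apply DifferentiableOn.analyticOnNhd _ hopen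
    intro z hz
    have : DifferentiableAt ℂ (fun s => mellin fractTail (-s)) z :=
      (differentiableAt_mellin_fractTail (s := -z) (by simpa using hz)).comp z
        differentiableAt_id.neg
    exact ((differentiableAt_const _).sub (differentiableAt_id.mul this)).differentiableWithinAt
  refine hf.eqOn_of_preconnected_of_eventuallyEq hg (z₀ := 2)
    (convex_halfSpace_re_gt 0).isPreconnected (by simp) ?_ hs
  have : {s : ℂ | 1 < s.re} ∈ 𝓝 (2 : ℂ) :=
    (isOpen_lt continuous_const Complex.continuous_re).mem_nhds (by simp)
  filter_upwards [this] with z hz using riemannZeta₀_eq_of_one_lt_re hz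

theorem norm_riemannZeta_le {s : ℂ} (hs : 1 / 2 ≤ s.re) (him : 1 ≤ s.im) :
    ‖riemannZeta s‖ ≤ 2 + 2 * ‖s‖ := by
  have hs1 : s ≠ 1 := by rintro rfl; norm_num at him
  rw [riemannZeta_eq_inv_sub_add hs1, riemannZeta₀_eq (by linarith)]
  have h1 : ‖(s - 1)⁻¹‖ ≤ 1 := by
    rw [norm_inv]
    apply inv_le_one_of_one_le₀
    have := Complex.abs_im_le_norm (s - 1)
    simp only [Complex.sub_im, Complex.one_im, sub_zero] at this
    exact him.trans ((le_abs_self _).trans this)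
  have h2 : ‖mellin fractTail (-s)‖ ≤ 2 := by
    refine (norm_mellin_fractTail_neg_le (by linarith)).trans ?_
    rw [div_le_iff₀ (by linarith)]; linarith
  calc _ ≤ ‖(s-1)⁻¹‖ + (‖(1:ℂ)‖ + ‖s * mellin fractTail (-s)‖) :=
        (norm_add_le _ _).trans (by gcongr; exact norm_sub_le _ _)
    _ ≤ 1 + (1 + ‖s‖ * 2) := by
        rw [norm_mul, norm_one]; gcongr
    _ = _ := by ring

theorem exists_norm_inv_riemannZeta_le :
    ∃ K : ℝ, 0 < K ∧ ∀ s : ℂ, 2 ≤ s.re → ‖(riemannZeta s)⁻¹‖ ≤ K := by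
  refine ⟨(∑' n, ‖LSeries.term (fun n => (ArithmeticFunction.moebius n : ℂ)) 2 n‖) + 1,
    by positivity, fun s hs => ?_⟩
  have hs1 : 1 < s.re := by linarith
  have h := ArithmeticFunction.LSeries_zeta_mul_Lseries_moebius hs1
  rw [ArithmeticFunction.LSeries_zeta_eq_riemannZeta hs1] at h
  rw [← eq_inv_of_mul_eq_one_right h]
  have hsum : LSeriesSummable (fun n => (ArithmeticFunction.moebius n : ℂ)) 2 := 
    ArithmeticFunction.LSeriesSummable_moebius_iff.2 (by norm_num)
  have hle : ∀ n, ‖LSeries.term (fun n => (ArithmeticFunction.moebius n : ℂ)) s n‖ ≤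
      ‖LSeries.term (fun n => (ArithmeticFunction.moebius n : ℂ)) 2 n‖ := fun n =>
    LSeries.norm_term_le_of_re_le_re _ (by simpa using hs) n
  have hsn := hsum.norm
  refine (norm_tsum_le_tsum_norm (hsn.of_nonneg_of_le (fun _ => norm_nonneg _) hle)).trans ?_
  have := (hsn.of_nonneg_of_le (fun _ => norm_nonneg _) hle).tsum_le_tsum hle hsn
  linarith

theorem exists_norm_logDeriv_riemannZeta_le
    (hRH : ∀ s : ℂ, 1 / 2 < s.re → 1 ≤ s.im → riemannZeta s ≠ 0) {η : ℝ} (hη : 0 < η) (hη' : η ≤ 1) :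
    ∃ C : ℝ, 0 < C ∧ ∀ s : ℂ, 1 / 2 + η ≤ s.re → s.re ≤ 5 → 6 ≤ s.im →
      ‖deriv riemannZeta s / riemannZeta s‖ ≤ C * Real.log s.im := by
  obtain ⟨K, hK, hKb⟩ := exists_norm_inv_riemannZeta_le
  set A : ℝ := |Real.log (30 * K)| + 1 with hA
  refine ⟨36 * (A + 1) / η ^ 2, by positivity, fun s hs1 hs2 hs3 => ?_⟩
  obtain ⟨t, ht⟩ : ∃ t : ℝ, t = s.im := ⟨_, rfl⟩
  rw [← ht] at hs3 ⊢
  obtain ⟨c, hc⟩ : ∃ c : ℂ, c = ⟨5, t⟩ := ⟨_, rfl⟩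
  obtain ⟨R, hR⟩ : ∃ R : ℝ, R = 9 / 2 := ⟨_, rfl⟩
  have hball : ∀ z ∈ Metric.ball c R, 1 / 2 < z.re ∧ 1 ≤ z.im ∧ ‖z‖ ≤ t + 10 := by
    intro z hz
    rw [Metric.mem_ball, dist_eq_norm] at hz
    have h1 := (Complex.abs_re_le_norm (z - c)).trans_lt hz
    have h2 := (Complex.abs_im_le_norm (z - c)).trans_lt hz
    simp only [Complex.sub_re, Complex.sub_im, hc] at h1 h2
    obtain ⟨h1, h1'⟩ := abs_lt.1 h1
    obtain ⟨h2, h2'⟩ := abs_lt.1 h2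
    refine ⟨by linarith, by linarith, ?_⟩
    have h3 : ‖c‖ ≤ 5 + t := by
      refine (Complex.norm_le_abs_re_add_abs_im c).trans ?_
      simp only [hc]
      rw [abs_of_nonneg (by linarith : (0:ℝ) ≤ t)]; norm_num
    have := norm_sub_norm_le z c
    linarith
  have hne : ∀ z ∈ Metric.ball c R, riemannZeta z ≠ 0 := fun z hz =>
    hRH z (hball z hz).1 (hball z hz).2.1
  have hz1 : ∀ z ∈ Metric.ball c R, z ≠ 1 := by
    rintro z hz rfl
    have := (hball 1 hz).2.1; norm_num at this
  have hdiff : DifferentiableOn ℂ riemannZeta (Metric.ball c R) := fun z hz =>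
    (differentiableAt_riemannZeta (hz1 z hz)).differentiableWithinAt
  have hld : DifferentiableOn ℂ (fun z => deriv riemannZeta z / riemannZeta z) (Metric.ball c R) :=
    (hdiff.deriv Metric.isOpen_ball).div hdiff hne
  obtain ⟨g, hg⟩ := hld.isExactOn_ball
  have hcb : c ∈ Metric.ball c R := Metric.mem_ball_self (by norm_num [hR])
  -- the exponential of the primitive is the normalised zeta function
  have hexp : ∀ z ∈ Metric.ball c R, riemannZeta z * Complex.exp (-(g z - g c)) = riemannZeta c := by
    intro z hz
    have hconst := (convex_ball c R).is_const_of_fderivWithin_eq_zero (𝕜 := ℂ)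
      (f := fun z => riemannZeta z * Complex.exp (-(g z - g c))) ?_ ?_ hz hcb
    · simpa using hconst
    · intro w hw
      exact ((differentiableAt_riemannZeta (hz1 w hw)).mul
        ((hg w hw).differentiableAt.sub_const _).neg.cexp).differentiableWithinAt
    · intro w hw
      have hd : HasDerivAt (fun z => riemannZeta z * Complex.exp (-(g z - g c))) 0 w := by
        refine ((differentiableAt_riemannZeta (hz1 w hw)).hasDerivAt.mul
          (((hg w hw).sub_const (g c)).neg.cexp)).congr_deriv ?_
        have := hne w hw
        simp only [Pi.neg_apply]
        field_simp
        ring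
      rw [fderivWithin_of_isOpen Metric.isOpen_ball hw]
      rw [hd.hasFDerivAt.fderiv]
      ext
      simp
  have hlogt : 1 ≤ Real.log t := by
    rw [Real.le_log_iff_exp_le (by linarith)]
    linarith [Real.exp_one_lt_d9]
  set M : ℝ := (A + 1) * Real.log t with hM
  have hMpos : 0 < M := by positivity
  have hre : ∀ z ∈ Metric.ball c R, (g z - g c).re ≤ M := by
    intro z hz
    have h1 := congrArg norm (hexp z hz)
    rw [norm_mul, Complex.norm_exp, Complex.neg_re, Real.exp_neg] at h1
    have hcz := norm_pos_iff.2 (hne c hcb)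
    have h2 : Real.exp (g z - g c).re = ‖riemannZeta z‖ * ‖(riemannZeta c)⁻¹‖ := by
      rw [norm_inv, ← h1]
      have := Real.exp_pos (g z - g c).re
      have := norm_pos_iff.2 (hne z hz)
      field_simp
    have h3 : Real.exp (g z - g c).re ≤ 30 * K * t := by
      rw [h2]
      have b1 := norm_riemannZeta_le (hball z hz).1.le (hball z hz).2.1
      have b2 := hKb c (by simp [hc]; norm_num)
      have b3 := (hball z hz).2.2
      calc _ ≤ (30 * t) * K := by
            gcongr; linarith
        _ = _ := by ring
    have h4 : (g z - g c).re ≤ Real.log (30 * K * t) := by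
      rw [Real.le_log_iff_exp_le (by positivity)]; exact h3
    rw [Real.log_mul (by positivity) (by linarith)] at h4
    have := le_abs_self (Real.log (30 * K))
    rw [hM, hA]
    nlinarith [abs_nonneg (Real.log (30 * K))]
  have hsc : dist s c ≤ R - η := by
    rw [dist_eq_norm, show s - c = ((s.re - 5 : ℝ) : ℂ) by
      apply Complex.ext <;> simp [hc, ht]]
    rw [Complex.norm_real, Real.norm_eq_abs, abs_le]
    constructor <;> norm_num [hR] <;> linarith
  have hmem : ∀ w : ℂ, dist w s ≤ η / 2 → w ∈ Metric.ball c R ∧ dist w c ≤ R - η / 2 := by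
    intro w hw
    have := dist_triangle w s c
    exact ⟨by rw [Metric.mem_ball]; linarith, by linarith⟩
  have hbd : ∀ w ∈ Metric.sphere s (η / 2), ‖g w - g c‖ ≤ 18 * M / η := by
    intro w hw
    obtain ⟨hw1, hw2⟩ := hmem w (Metric.mem_sphere.1 hw).le
    have hshift : ∀ z ∈ Metric.ball (0:ℂ) R, c + z ∈ Metric.ball c R := by
      intro z hz; simpa [dist_eq_norm] using hz
    have := Complex.borelCaratheodory_zero (f := fun z => g (c + z) - g c) (R := R) (z := w - c)
      hMpos ?_ (fun z hz => hre _ (hshift z hz)) (by norm_num [hR])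
      (by simpa [dist_eq_norm] using hw1) (by simp)
    · simp only [add_sub_cancel] at this
      refine this.trans ?_
      rw [← dist_eq_norm]
      have hη2 : 0 < η / 2 := by positivity
      calc 2 * M * dist w c / (R - dist w c) ≤ 2 * M * R / (η / 2) := by
            gcongr
            · linarith
            · linarith
        _ = 18 * M / η := by rw [hR]; field_simp; ring
    · intro z hz
      have h5 : HasDerivAt (fun z => g (c + z) - g c) _ z :=
        ((hg (c + z) (hshift z hz)).comp_const_add c z).sub_const (g c)
      exact h5.differentiableAt.differentiableWithinAt
  have hder := Complex.norm_deriv_le_of_forall_mem_sphere_norm_le (f := fun w => g w - g c)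
    (c := s) (R := η / 2) (C := 18 * M / η) (by positivity) ?_ hbd
  · have hs_mem := (hmem s (by simp; positivity)).1
    rw [((hg s hs_mem).sub_const (g c)).deriv] at hder
    refine hder.trans (le_of_eq ?_)
    rw [hM]; field_simp; ring
  · apply DifferentiableOn.diffContOnCl
    intro w hw
    rw [closure_ball _ (by positivity)] at hw
    exact ((hg w (hmem w hw).1).sub_const (g c)).differentiableAt.differentiableWithinAt

section mellin_support

variable {w : ℝ → ℂ} {α β : ℝ}

theorem isBigO_atTop_of_support_subset (hsupp : ∀ v, v ∉ Icc α β → w v = 0) (c : ℝ) :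
    w =O[atTop] fun x => x ^ c := by
  refine (Filter.EventuallyEq.trans_isBigO (f₂ := fun _ => (0 : ℂ)) ?_
    (Asymptotics.isBigO_zero _ _))
  filter_upwards [eventually_gt_atTop β] with v hv
  exact hsupp v fun h => absurd h.2 (not_le.2 hv)

theorem isBigO_zero_of_support_subset (hα : 0 < α) (hsupp : ∀ v, v ∉ Icc α β → w v = 0) (c : ℝ) :
    w =O[𝓝[>] 0] fun x => x ^ c := by
  refine (Filter.EventuallyEq.trans_isBigO (f₂ := fun _ => (0 : ℂ)) ?_
    (Asymptotics.isBigO_zero _ _))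
  filter_upwards [mem_nhdsWithin_of_mem_nhds (Iio_mem_nhds hα)] with v hv
  exact hsupp v fun h => absurd h.1 (not_le.2 hv)

theorem mellinConvergent_of_support_subset (hα : 0 < α) (hw : Continuous w)
    (hsupp : ∀ v, v ∉ Icc α β → w v = 0) (s : ℂ) : MellinConvergent w s :=
  mellinConvergent_of_isBigO_rpow (a := s.re + 1) (b := s.re - 1)
    (hw.locallyIntegrable.locallyIntegrableOn _) (isBigO_atTop_of_support_subset hsupp _)
    (by linarith) (isBigO_zero_of_support_subset hα hsupp _) (by linarith)

theorem differentiable_mellin_of_support_subset (hα : 0 < α) (hw : Continuous w)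
    (hsupp : ∀ v, v ∉ Icc α β → w v = 0) : Differentiable ℂ (mellin w) := fun s =>
  mellin_differentiableAt_of_isBigO_rpow (a := s.re + 1) (b := s.re - 1)
    (hw.locallyIntegrable.locallyIntegrableOn _) (isBigO_atTop_of_support_subset hsupp _)
    (by linarith) (isBigO_zero_of_support_subset hα hsupp _) (by linarith)

end mellin_support

/-- The integral of `(1 + |τ|) ^ (-3/2)` over the line. -/
def decayIntegral : ℝ := ∫ τ : ℝ, (1 + ‖τ‖) ^ (-(3 / 2) : ℝ)

theorem integrable_decay : Integrable fun τ : ℝ => (1 + ‖τ‖) ^ (-(3 / 2) : ℝ) :=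
  integrable_one_add_norm (by norm_num)

theorem decayIntegral_nonneg : 0 ≤ decayIntegral :=
  integral_nonneg fun _ => by positivity

theorem LSeries.term_eq_mul_cpow_neg (a : ℕ → ℂ) (s : ℂ) {n : ℕ} (hn : n ≠ 0) :
    LSeries.term a s n = a n * (n : ℂ) ^ (-s) := by
  rw [LSeries.term_of_ne_zero hn, Complex.cpow_neg, div_eq_mul_inv]

theorem norm_tsum_mul_le_of_mellin {a : ℕ → ℂ} {D : ℂ → ℂ} {w : ℝ → ℂ} {α β σ₁ σ₂ t₁ t₂ E E' : ℝ}
    (hα : 0 < α) (hw : Continuous w) (hsupp : ∀ v, v ∉ Icc α β → w v = 0)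
    (hσ : σ₁ ≤ σ₂) (ht : t₁ ≤ t₂) (ha : LSeriesSummable a σ₂)
    (hD : ∀ τ : ℝ, D (σ₂ + τ * Complex.I) = LSeries a (σ₂ + τ * Complex.I))
    (hdiff : ∀ s : ℂ, σ₁ ≤ s.re → s.re ≤ σ₂ → t₁ ≤ s.im → s.im ≤ t₂ → DifferentiableAt ℂ D s)
    (hE : ∀ τ : ℝ, τ ∉ Icc t₁ t₂ → ‖mellin w (σ₂ + τ * Complex.I)‖ ≤ E * (1 + ‖τ‖) ^ (-(3 / 2) : ℝ))
    (hE₁ : ∀ σ ∈ Icc σ₁ σ₂, ‖D (σ + t₁ * Complex.I) * mellin w (σ + t₁ * Complex.I)‖ ≤ E')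
    (hE₂ : ∀ σ ∈ Icc σ₁ σ₂, ‖D (σ + t₂ * Complex.I) * mellin w (σ + t₂ * Complex.I)‖ ≤ E') :
    ‖∑' n : ℕ, a n * w n‖ ≤ (∑' n, ‖LSeries.term a σ₂ n‖) * E * decayIntegral +
      2 * E' * (σ₂ - σ₁) +
      ∫ τ in t₁..t₂, ‖D (σ₁ + τ * Complex.I) * mellin w (σ₁ + τ * Complex.I)‖ := by
  have hWd := differentiable_mellin_of_support_subset hα hw hsupp
  have hline : ∀ σ : ℝ, Continuous fun τ : ℝ => (σ + τ * Complex.I : ℂ) := fun σ => by fun_prop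
  have hWc : ∀ σ : ℝ, Continuous fun τ : ℝ => mellin w (σ + τ * Complex.I) := fun σ =>
    hWd.continuous.comp (hline σ)
  have hWout : IntegrableOn (fun τ : ℝ => mellin w (σ₂ + τ * Complex.I)) (Icc t₁ t₂)ᶜ := by
    refine Integrable.mono' (integrable_decay.const_mul E).integrableOn
      (hWc σ₂).aestronglyMeasurable.restrict ?_
    filter_upwards [ae_restrict_mem measurableSet_Icc.compl] with τ hτ using hE τ hτ
  have hWint : Integrable fun τ : ℝ => mellin w (σ₂ + τ * Complex.I) := by
    rw [← integrableOn_univ, ← union_compl_self (Icc t₁ t₂)]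
    exact ((hWc σ₂).integrableOn_Icc).union hWout
  set A := ∑' n, ‖LSeries.term a σ₂ n‖ with hA
  have hnormterm : ∀ (n : ℕ) (τ : ℝ), ‖LSeries.term a (σ₂ + τ * Complex.I) n‖ =
      ‖LSeries.term a σ₂ n‖ := fun n τ => by
    simp [LSeries.norm_term_eq]
  have hinv : ∀ n : ℕ, n ≠ 0 → w n = (1 / (2 * Real.pi) : ℝ) •
      ∫ τ : ℝ, (n : ℂ) ^ (-(σ₂ + τ * Complex.I : ℂ)) * mellin w (σ₂ + τ * Complex.I) := by
    intro n hn
    rw [← mellinInv_mellin_eq σ₂ w (x := n) (by positivity)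
      (mellinConvergent_of_support_subset hα hw hsupp _) hWint hw.continuousAt]
    simp [mellinInv]
  set F : ℕ → ℝ → ℂ := fun n τ =>
    LSeries.term a (σ₂ + τ * Complex.I) n * mellin w (σ₂ + τ * Complex.I) with hF
  have hFc : ∀ n, Continuous fun τ : ℝ => LSeries.term a (σ₂ + τ * Complex.I) n := by
    intro n
    rcases eq_or_ne n 0 with rfl | hn
    · simpa using continuous_const
    · simp only [LSeries.term_eq_mul_cpow_neg _ _ hn]
      have : (n : ℂ) ≠ 0 := by exact_mod_cast hn
      exact continuous_const.mul
        ((hline σ₂).neg.const_cpow (Or.inl this))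
  have hFint : ∀ n, Integrable (F n) := fun n =>
    hWint.bdd_mul (c := ‖LSeries.term a σ₂ n‖) (hFc n).aestronglyMeasurable
      (Eventually.of_forall fun τ => (hnormterm n τ).le)
  have hFnorm : ∀ n, ∫ τ, ‖F n τ‖ = ‖LSeries.term a σ₂ n‖ *
      ∫ τ : ℝ, ‖mellin w (σ₂ + τ * Complex.I)‖ := by
    intro n
    simp only [hF, norm_mul, hnormterm]
    rw [integral_const_mul]
  have hsum := hasSum_integral_of_summable_integral_norm hFint (by
    simp only [hFnorm]
    exact ha.norm.mul_right _)
  have hDW : ∀ τ : ℝ, ∑' n, F n τ = D (σ₂ + τ * Complex.I) * mellin w (σ₂ + τ * Complex.I) := by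
    intro τ
    rw [hD, LSeries, tsum_mul_right]
  have hterm : ∀ n, a n * w n = (1 / (2 * Real.pi) : ℝ) • ∫ τ, F n τ := by
    intro n
    rcases eq_or_ne n 0 with rfl | hn
    · rw [hsupp]
      · simp [hF]
      · simp [hα]
    · rw [hinv n hn, mul_smul_comm, ← integral_const_mul]
      simp only [hF, LSeries.term_eq_mul_cpow_neg _ _ hn, mul_assoc]
  set G : ℂ → ℂ := fun s => D s * mellin w s with hG
  have hDbd : ∀ τ : ℝ, ‖D (σ₂ + τ * Complex.I)‖ ≤ A := by
    intro τ
    rw [hD, LSeries]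
    have : Summable fun n => ‖LSeries.term a (σ₂ + τ * Complex.I) n‖ := by
      simpa only [hnormterm] using ha.norm
    refine (norm_tsum_le_tsum_norm this).trans_eq ?_
    simp only [hnormterm, hA]
  have hGint : Integrable fun τ : ℝ => G (σ₂ + τ * Complex.I) := by
    refine hWint.bdd_mul (c := A) ?_ (Eventually.of_forall hDbd)
    have : (fun τ : ℝ => D (σ₂ + τ * Complex.I)) =
        fun τ : ℝ => ∑' n, LSeries.term a (σ₂ + τ * Complex.I) n := funext fun τ => hD τ
    rw [this]
    exact (continuous_tsum hFc ha.norm fun n τ => (hnormterm n τ).le).aestronglyMeasurable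
  have hmain : ∑' n : ℕ, a n * w n = (1 / (2 * Real.pi) : ℝ) • ∫ τ : ℝ, G (σ₂ + τ * Complex.I) := by
    simp only [hterm]
    rw [tsum_const_smul'', hsum.tsum_eq]
    simp only [hDW, hG]
  have hsplit := integral_add_compl (measurableSet_Icc (a := t₁) (b := t₂)) hGint
  have hout : ‖∫ τ in (Icc t₁ t₂)ᶜ, G (σ₂ + τ * Complex.I)‖ ≤ A * E * decayIntegral := by
    have hA0 : 0 ≤ A := tsum_nonneg fun _ => norm_nonneg _
    by_cases hne : (Icc t₁ t₂)ᶜ.Nonempty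
    · obtain ⟨τ₀, hτ₀⟩ := hne
      have hE0 : 0 ≤ E := by
        have := (norm_nonneg _).trans (hE τ₀ hτ₀)
        exact nonneg_of_mul_nonneg_left this (by positivity)
      calc _ ≤ ∫ τ in (Icc t₁ t₂)ᶜ, A * E * (1 + ‖τ‖) ^ (-(3 / 2) : ℝ) := by
            refine norm_integral_le_of_norm_le (integrable_decay.const_mul _).integrableOn ?_
            filter_upwards [ae_restrict_mem measurableSet_Icc.compl] with τ hτ
            rw [hG, norm_mul, mul_assoc]
            exact mul_le_mul (hDbd τ) (hE τ hτ) (norm_nonneg _) hA0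
        _ ≤ ∫ τ : ℝ, A * E * (1 + ‖τ‖) ^ (-(3 / 2) : ℝ) :=
            setIntegral_le_integral (integrable_decay.const_mul _)
              (Eventually.of_forall fun τ => by positivity)
        _ = _ := by rw [integral_const_mul, decayIntegral]
    · exact absurd (show t₂ + 1 ∈ (Icc t₁ t₂)ᶜ by simp) (fun h => hne ⟨_, h⟩)
  have hrect := Complex.integral_boundary_rect_eq_zero_of_differentiableOn G
    (σ₁ + t₁ * Complex.I) (σ₂ + t₂ * Complex.I) ?_
  swap
  · intro s hs
    rw [Complex.mem_reProdIm] at hs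
    simp only [Complex.add_re, Complex.ofReal_re, Complex.mul_re, Complex.I_re, mul_zero,
      Complex.ofReal_im, Complex.I_im, mul_one, sub_self, add_zero, Complex.add_im, Complex.mul_im,
      zero_add, uIcc_of_le hσ, uIcc_of_le ht] at hs
    exact ((hdiff s hs.1.1 hs.1.2 hs.2.1 hs.2.2).mul (hWd s)).differentiableWithinAt
  simp only [Complex.add_re, Complex.ofReal_re, Complex.mul_re, Complex.I_re, mul_zero,
    Complex.ofReal_im, Complex.I_im, mul_one, sub_self, add_zero, Complex.add_im, Complex.mul_im,
    zero_add, smul_eq_mul] at hrect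
  have hh₁ : ‖∫ σ in σ₁..σ₂, G (σ + t₁ * Complex.I)‖ ≤ E' * (σ₂ - σ₁) := by
    rw [← abs_of_nonneg (sub_nonneg.2 hσ)]
    refine intervalIntegral.norm_integral_le_of_norm_le_const fun σ hs => hE₁ σ ?_
    rw [uIoc_of_le hσ] at hs
    exact ⟨hs.1.le, hs.2⟩
  have hh₂ : ‖∫ σ in σ₁..σ₂, G (σ + t₂ * Complex.I)‖ ≤ E' * (σ₂ - σ₁) := by
    rw [← abs_of_nonneg (sub_nonneg.2 hσ)]
    refine intervalIntegral.norm_integral_le_of_norm_le_const fun σ hs => hE₂ σ ?_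
    rw [uIoc_of_le hσ] at hs
    exact ⟨hs.1.le, hs.2⟩
  have hl : ‖∫ τ in t₁..t₂, G (σ₁ + τ * Complex.I)‖ ≤
      ∫ τ in t₁..t₂, ‖G (σ₁ + τ * Complex.I)‖ :=
    intervalIntegral.norm_integral_le_integral_norm ht
  have hright : ‖∫ τ in t₁..t₂, G (σ₂ + τ * Complex.I)‖ ≤ 2 * E' * (σ₂ - σ₁) +
      ∫ τ in t₁..t₂, ‖G (σ₁ + τ * Complex.I)‖ := by
    have e : Complex.I * ∫ τ in t₁..t₂, G (σ₂ + τ * Complex.I) =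
        Complex.I * (∫ τ in t₁..t₂, G (σ₁ + τ * Complex.I)) -
        (∫ σ in σ₁..σ₂, G (σ + t₁ * Complex.I)) + ∫ σ in σ₁..σ₂, G (σ + t₂ * Complex.I) := by
      linear_combination hrect
    have e' := congrArg norm e
    rw [norm_mul, Complex.norm_I, one_mul] at e'
    rw [e']
    refine (norm_add_le _ _).trans ?_
    have := norm_sub_le (Complex.I * ∫ τ in t₁..t₂, G (σ₁ + τ * Complex.I))
      (∫ σ in σ₁..σ₂, G (σ + t₁ * Complex.I))
    rw [norm_mul, Complex.norm_I, one_mul] at this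
    linarith
  rw [hmain, norm_smul]
  have hpi : ‖(1 / (2 * Real.pi) : ℝ)‖ ≤ 1 := by
    rw [Real.norm_of_nonneg (by positivity)]
    rw [div_le_one (by positivity)]
    linarith [Real.pi_gt_three]
  refine (mul_le_of_le_one_left (norm_nonneg _) hpi).trans ?_
  rw [← hsplit, integral_Icc_eq_integral_Ioc, ← intervalIntegral.integral_of_le ht]
  refine (norm_add_le _ _).trans ?_
  linarith

/-- The continuous function equal to `1` up to `N`, to `0` from `N + 1` on, and affine between. -/
def ramp (N : ℕ) (v : ℝ) : ℝ := max 0 (min 1 (N + 1 - v))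

theorem ramp_of_le {N : ℕ} {v : ℝ} (h : v ≤ N) : ramp N v = 1 := by
  rw [ramp, min_eq_left (by linarith), max_eq_right zero_le_one]

theorem ramp_of_ge {N : ℕ} {v : ℝ} (h : N + 1 ≤ v) : ramp N v = 0 := by
  rw [ramp, max_eq_left]
  exact (min_le_right _ _).trans (by linarith)

theorem ramp_of_mem {N : ℕ} {v : ℝ} (h₁ : N ≤ v) (h₂ : v ≤ N + 1) : ramp N v = N + 1 - v := by
  rw [ramp, min_eq_right (by linarith), max_eq_right (by linarith)]

theorem continuous_ramp (N : ℕ) : Continuous (ramp N) := by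
  unfold ramp; fun_prop

/-- A continuous cutoff to the integers in `(N₀, N]`. -/
def trapezoid (N₀ N : ℕ) (v : ℝ) : ℂ := (ramp N v - ramp N₀ v : ℝ)

theorem continuous_trapezoid (N₀ N : ℕ) : Continuous (trapezoid N₀ N) :=
  Complex.continuous_ofReal.comp ((continuous_ramp N).sub (continuous_ramp N₀))

theorem trapezoid_eq_zero {N₀ N : ℕ} (h : N₀ ≤ N) {v : ℝ} (hv : v ∉ Icc (N₀ : ℝ) (N + 1)) :
    trapezoid N₀ N v = 0 := by
  have h' : (N₀ : ℝ) ≤ N := by exact_mod_cast h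
  rw [mem_Icc, not_and_or, not_le, not_le] at hv
  rcases hv with hv | hv
  · rw [trapezoid, ramp_of_le (by linarith), ramp_of_le hv.le]; simp
  · rw [trapezoid, ramp_of_ge hv.le, ramp_of_ge (by linarith)]; simp

theorem trapezoid_natCast (N₀ N n : ℕ) (h : N₀ ≤ N) :
    trapezoid N₀ N n = if n ∈ Finset.Ioc N₀ N then 1 else 0 := by
  simp only [Finset.mem_Ioc, trapezoid]
  rcases le_or_gt n N₀ with h₁ | h₁
  · rw [ramp_of_le (by exact_mod_cast h₁.trans h), ramp_of_le (by exact_mod_cast h₁),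
      if_neg (by omega)]
    simp
  · rw [ramp_of_ge (N := N₀) (by exact_mod_cast h₁)]
    rcases le_or_gt n N with h₂ | h₂
    · rw [ramp_of_le (by exact_mod_cast h₂), if_pos ⟨h₁, h₂⟩]; simp
    · rw [ramp_of_ge (by exact_mod_cast h₂), if_neg (by omega)]; simp

/-- The increment of `v ^ (u + 1)` over `[N, N + 1]`. -/
def powIncr (N : ℕ) (u : ℂ) : ℂ := ((N + 1 : ℝ) : ℂ) ^ (u + 1) - ((N : ℝ) : ℂ) ^ (u + 1)

theorem integral_affine_mul_cpow {a b : ℝ} (ha : 0 < a) (hb : 0 < b) (c d u : ℂ) (hu : u ≠ 0)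
    (hu' : u + 1 ≠ 0) :
    ∫ v in a..b, (v : ℂ) ^ (u - 1) * (c + d * v) =
      c * (((b : ℂ) ^ u - (a : ℂ) ^ u) / u) +
        d * (((b : ℂ) ^ (u + 1) - (a : ℂ) ^ (u + 1)) / (u + 1)) := by
  have h0 : (0 : ℝ) ∉ uIcc a b := by
    rw [mem_uIcc]; intro h; rcases h with h | h <;> linarith [h.1, h.2]
  have h1 := integral_cpow (a := a) (b := b) (r := u - 1)
    (Or.inr ⟨fun h => hu (by linear_combination h), h0⟩)
  have h2 := integral_cpow (a := a) (b := b) (r := u)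
    (Or.inr ⟨fun h => hu' (by linear_combination h), h0⟩)
  have hi : ∀ r : ℂ, IntervalIntegrable (fun v : ℝ => (v : ℂ) ^ r) volume a b := fun r =>
    intervalIntegral.intervalIntegrable_cpow (Or.inr h0)
  rw [sub_add_cancel] at h1
  rw [← h1, ← h2, ← intervalIntegral.integral_const_mul, ← intervalIntegral.integral_const_mul,
    ← intervalIntegral.integral_add ((hi _).const_mul _) ((hi _).const_mul _)]
  refine intervalIntegral.integral_congr fun v hv => ?_
  have hv0 : (v : ℂ) ≠ 0 := by
    intro h; exact h0 ((by exact_mod_cast h : v = 0) ▸ hv)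
  have : (v : ℂ) ^ u = (v : ℂ) ^ (u - 1) * v := by
    rw [Complex.cpow_sub _ _ hv0, Complex.cpow_one, div_mul_cancel₀ _ hv0]
  simp only [this]
  ring

theorem mellin_trapezoid {N₀ N : ℕ} (h₀ : 0 < N₀) (h : N₀ < N) {u : ℂ} (hu : u ≠ 0)
    (hu' : u + 1 ≠ 0) :
    mellin (trapezoid N₀ N) u = (powIncr N u - powIncr N₀ u) / (u * (u + 1)) := by
  have h₀' : (0 : ℝ) < N₀ := by exact_mod_cast h₀
  have h' : (N₀ : ℝ) + 1 ≤ N := by exact_mod_cast h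
  have hsub : Ioc (N₀ : ℝ) (N + 1) ⊆ Ioi 0 := fun v hv => h₀'.trans hv.1
  have hm : mellin (trapezoid N₀ N) u =
      ∫ v in (N₀ : ℝ)..(N + 1), (v : ℂ) ^ (u - 1) * trapezoid N₀ N v := by
    rw [mellin, intervalIntegral.integral_of_le (by linarith)]
    simp only [smul_eq_mul]
    refine setIntegral_eq_of_subset_of_forall_sdiff_eq_zero measurableSet_Ioi hsub ?_
    intro v hv
    rcases eq_or_ne v N₀ with rfl | hne
    · rw [trapezoid_natCast _ _ _ h.le]; simp
    · rw [trapezoid_eq_zero h.le, mul_zero]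
      intro hv'
      exact hv.2 ⟨lt_of_le_of_ne hv'.1 hne.symm, hv'.2⟩
  have hInt : ∀ a b : ℝ, 0 < a → a ≤ b →
      IntervalIntegrable (fun v : ℝ => (v : ℂ) ^ (u - 1) * trapezoid N₀ N v) volume a b := by
    intro a b ha hab
    refine ContinuousOn.intervalIntegrable fun v hv => ?_
    rw [uIcc_of_le hab] at hv
    refine ContinuousAt.continuousWithinAt ?_
    exact (Complex.continuousAt_ofReal_cpow_const _ _ (Or.inr (ha.trans_le hv.1).ne')).mul
      (continuous_trapezoid _ _).continuousAt
  have e1 : ∫ v in (N₀ : ℝ)..(N₀ + 1), (v : ℂ) ^ (u - 1) * trapezoid N₀ N v =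
      ∫ v in (N₀ : ℝ)..(N₀ + 1), (v : ℂ) ^ (u - 1) * (-(N₀ : ℂ) + 1 * v) := by
    refine intervalIntegral.integral_congr fun v hv => ?_
    rw [uIcc_of_le (by linarith)] at hv
    simp only [trapezoid, ramp_of_le (hv.2.trans h'), ramp_of_mem hv.1 hv.2]
    push_cast; ring
  have e2 : ∫ v in (N₀ + 1 : ℝ)..N, (v : ℂ) ^ (u - 1) * trapezoid N₀ N v =
      ∫ v in (N₀ + 1 : ℝ)..N, (v : ℂ) ^ (u - 1) * (1 + 0 * v) := by
    refine intervalIntegral.integral_congr fun v hv => ?_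
    rw [uIcc_of_le (by linarith)] at hv
    simp only [trapezoid, ramp_of_le hv.2, ramp_of_ge hv.1]
    push_cast; ring
  have e3 : ∫ v in (N : ℝ)..(N + 1), (v : ℂ) ^ (u - 1) * trapezoid N₀ N v =
      ∫ v in (N : ℝ)..(N + 1), (v : ℂ) ^ (u - 1) * ((N + 1 : ℂ) + (-1) * v) := by
    refine intervalIntegral.integral_congr fun v hv => ?_
    rw [uIcc_of_le (by linarith)] at hv
    simp only [trapezoid, ramp_of_mem hv.1 hv.2, ramp_of_ge (h'.trans hv.1)]
    push_cast; ring
  rw [hm, ← intervalIntegral.integral_add_adjacent_intervals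
      (hInt N₀ (N₀ + 1) h₀' (by linarith)) (hInt (N₀ + 1) (N + 1) (by linarith) (by linarith)),
    ← intervalIntegral.integral_add_adjacent_intervals
      (hInt (N₀ + 1) N (by linarith) h') (hInt N (N + 1) (by linarith) (by linarith)), e1, e2, e3,
    integral_affine_mul_cpow (by linarith) (by linarith) _ _ _ hu hu',
    integral_affine_mul_cpow (by linarith) (by linarith) _ _ _ hu hu',
    integral_affine_mul_cpow (by linarith) (by linarith) _ _ _ hu hu', powIncr, powIncr]
  have hp : ∀ v : ℝ, 0 < v → (v : ℂ) ^ (u + 1) = (v : ℂ) ^ u * v := fun v hv => by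
    rw [Complex.cpow_add _ _ (by exact_mod_cast hv.ne'), Complex.cpow_one]
  rw [hp (N₀ + 1) (by linarith), hp N₀ h₀', hp N (by linarith), hp (N + 1) (by linarith)]
  push_cast
  field_simp
  ring

theorem norm_powIncr_le {N : ℕ} (hN : 0 < N) {u : ℂ} {r : ℝ} (hu : u.re + 1 ≤ r) (hr : 0 ≤ r) :
    ‖powIncr N u‖ ≤ 2 * (N + 1 : ℝ) ^ r := by
  have hN' : (1 : ℝ) ≤ N := by exact_mod_cast hN
  refine (norm_sub_le _ _).trans ?_
  rw [Complex.norm_cpow_eq_rpow_re_of_pos (by linarith),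
    Complex.norm_cpow_eq_rpow_re_of_pos (by linarith)]
  simp only [Complex.add_re, Complex.one_re]
  have h1 : (N + 1 : ℝ) ^ (u.re + 1) ≤ (N + 1 : ℝ) ^ r :=
    Real.rpow_le_rpow_of_exponent_le (by linarith) hu
  have h2 : (N : ℝ) ^ (u.re + 1) ≤ (N + 1 : ℝ) ^ r :=
    (Real.rpow_le_rpow_of_exponent_le hN' hu).trans
      (Real.rpow_le_rpow (by linarith) (by linarith) hr)
  linarith

theorem norm_powIncr_div_le {N : ℕ} (hN : 0 < N) {u : ℂ} (hu : u.re ≤ 0) (hu' : u + 1 ≠ 0) :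
    ‖powIncr N u / (u + 1)‖ ≤ (N : ℝ) ^ u.re := by
  have hN' : (1 : ℝ) ≤ N := by exact_mod_cast hN
  have h := integral_cpow (a := N) (b := N + 1) (r := u)
    (Or.inr ⟨fun h => hu' (by linear_combination h), by
      rw [uIcc_of_le (by linarith)]; intro h; linarith [h.1]⟩)
  rw [powIncr, ← h]
  refine (intervalIntegral.norm_integral_le_of_norm_le_const (C := (N : ℝ) ^ u.re)
    fun v hv => ?_).trans (by simp)
  rw [uIoc_of_le (by linarith)] at hv
  rw [Complex.norm_cpow_eq_rpow_re_of_pos (by linarith [hv.1])]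
  exact Real.rpow_le_rpow_of_nonpos (by linarith) hv.1.le hu

/-- Bound for the Mellin transform of the trapezoid to the left of the imaginary axis. -/
theorem norm_mellin_trapezoid_le_left {N₀ N : ℕ} (h₀ : 0 < N₀) (h : N₀ < N) {η : ℝ} (hη : 0 < η)
    (hη' : η ≤ 1 / 4) (τ : ℝ) :
    ‖mellin (trapezoid N₀ N) ((-η : ℝ) + τ * Complex.I)‖ ≤
      16 * (2 / η) ^ (1 + η / 2) * (N₀ : ℝ) ^ (-(η / 2)) * (1 + ‖τ‖) ^ (-(1 + η / 2)) := by
  obtain ⟨u, hu⟩ : ∃ u : ℂ, u = (-η : ℝ) + τ * Complex.I := ⟨_, rfl⟩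
  have hre : u.re = -η := by simp [hu]
  have him : u.im = τ := by simp [hu]
  have hu0 : u ≠ 0 := by
    intro h; rw [h] at hre; simp at hre; linarith
  have hu1 : u + 1 ≠ 0 := by
    intro h; have := congrArg Complex.re h; simp [hre] at this; linarith
  have hle : ‖u‖ ≤ 2 * ‖u + 1‖ := by
    have h1 : (3 / 4 : ℝ) ≤ ‖u + 1‖ := by
      refine le_trans ?_ (Complex.re_le_norm _)
      simp [hre]; linarith
    have h2 : |τ| ≤ ‖u + 1‖ := by
      have := Complex.abs_im_le_norm (u + 1); simpa [him] using this
    have h3 := Complex.norm_le_abs_re_add_abs_im u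
    rw [hre, him, abs_neg, abs_of_pos hη] at h3
    linarith
  have hpos : 0 < ‖u‖ := norm_pos_iff.2 hu0
  have hlow : (1 + ‖τ‖) * (η / 2) ≤ ‖u‖ := by
    have h1 := Complex.abs_re_le_norm u
    have h2 := Complex.abs_im_le_norm u
    rw [hre, abs_neg, abs_of_pos hη] at h1
    rw [him] at h2
    rw [Real.norm_eq_abs]
    nlinarith [abs_nonneg τ]
  have hone : ∀ n : ℕ, 0 < n → ‖powIncr n u / (u + 1)‖ ≤ 8 * (n : ℝ) ^ (-(η / 2)) * ‖u‖ ^ (-(η / 2)) := by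
    intro n hn
    have hn' : (1 : ℝ) ≤ n := by exact_mod_cast hn
    have b1 := norm_powIncr_div_le hn (by linarith) hu1
    rw [hre] at b1
    have b2 : ‖powIncr n u / (u + 1)‖ ≤ 8 * (n : ℝ) ^ (1 - η) * ‖u‖⁻¹ := by
      rw [norm_div]
      have := norm_powIncr_le hn (u := u) (r := 1 - η) (by linarith) (by linarith)
      have h3 : (n + 1 : ℝ) ^ (1 - η) ≤ 2 * (n : ℝ) ^ (1 - η) := by
        calc (n + 1 : ℝ) ^ (1 - η) ≤ (2 * n : ℝ) ^ (1 - η) :=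
              Real.rpow_le_rpow (by linarith) (by linarith) (by linarith)
          _ = 2 ^ (1 - η) * (n : ℝ) ^ (1 - η) := Real.mul_rpow (by norm_num) (by linarith)
          _ ≤ 2 ^ (1 : ℝ) * (n : ℝ) ^ (1 - η) := by
              gcongr
              · norm_num
              · linarith
          _ = _ := by rw [Real.rpow_one]
      have hp : 0 < ‖u + 1‖ := norm_pos_iff.2 hu1
      rw [div_le_iff₀ hp]
      calc ‖powIncr n u‖ ≤ 4 * (n : ℝ) ^ (1 - η) := by linarith
        _ = 8 * (n : ℝ) ^ (1 - η) * ‖u‖⁻¹ * (‖u‖ / 2) := by field_simp; norm_num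
        _ ≤ _ := by gcongr; linarith
    rcases le_or_gt ‖u‖ n with hun | hun
    · refine b1.trans ?_
      have : (1 : ℝ) ≤ 8 := by norm_num
      calc (n : ℝ) ^ (-η) = (n : ℝ) ^ (-(η / 2)) * (n : ℝ) ^ (-(η / 2)) := by
            rw [← Real.rpow_add (by linarith : (0 : ℝ) < n)]; ring_nf
        _ ≤ (n : ℝ) ^ (-(η / 2)) * ‖u‖ ^ (-(η / 2)) := by
            exact mul_le_mul_of_nonneg_left
              (Real.rpow_le_rpow_of_nonpos hpos hun (neg_nonpos.2 (half_pos hη).le)) (by positivity)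
        _ ≤ _ := by
            rw [mul_assoc]
            exact le_mul_of_one_le_left (by positivity) this
    · refine b2.trans ?_
      have : (n : ℝ) ^ (1 - η) * ‖u‖⁻¹ ≤ (n : ℝ) ^ (-(η / 2)) * ‖u‖ ^ (-(η / 2)) := by
        calc (n : ℝ) ^ (1 - η) * ‖u‖⁻¹
            = (n : ℝ) ^ (-(η / 2)) * (n : ℝ) ^ (1 - η / 2) * ‖u‖⁻¹ := by
              rw [← Real.rpow_add (by linarith : (0 : ℝ) < n)]; ring_nf
          _ ≤ (n : ℝ) ^ (-(η / 2)) * ‖u‖ ^ (1 - η / 2) * ‖u‖⁻¹ := by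
              gcongr
              linarith
          _ = _ := by
              rw [mul_assoc, ← Real.rpow_neg_one ‖u‖, ← Real.rpow_add hpos]; ring_nf
      nlinarith
  rw [← hu, mellin_trapezoid h₀ h hu0 hu1]
  have hNN : (N : ℝ) ^ (-(η / 2)) ≤ (N₀ : ℝ) ^ (-(η / 2)) :=
    Real.rpow_le_rpow_of_nonpos (by exact_mod_cast h₀) (by exact_mod_cast h.le) (by linarith)
  have e : (powIncr N u - powIncr N₀ u) / (u * (u + 1)) =
      (powIncr N u / (u + 1) - powIncr N₀ u / (u + 1)) / u := by field_simp
  rw [e, norm_div]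
  have h4 : ‖powIncr N u / (u + 1) - powIncr N₀ u / (u + 1)‖ ≤
      16 * (N₀ : ℝ) ^ (-(η / 2)) * ‖u‖ ^ (-(η / 2)) := by
    refine (norm_sub_le _ _).trans ?_
    have q1 := hone N (h₀.trans h)
    have q2 := hone N₀ h₀
    have : 0 ≤ ‖u‖ ^ (-(η / 2)) := by positivity
    nlinarith
  have h5 : ‖u‖ ^ (-(1 + η / 2)) ≤ (2 / η) ^ (1 + η / 2) * (1 + ‖τ‖) ^ (-(1 + η / 2)) := by
    refine (Real.rpow_le_rpow_of_nonpos (by positivity) hlow (by linarith)).trans_eq ?_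
    rw [Real.mul_rpow (by positivity) (by positivity), mul_comm, Real.rpow_neg (by positivity : 0 ≤ η / 2),
      ← Real.inv_rpow (by positivity), inv_div]
  calc _ ≤ 16 * (N₀ : ℝ) ^ (-(η / 2)) * ‖u‖ ^ (-(η / 2)) / ‖u‖ := by gcongr
    _ = 16 * (N₀ : ℝ) ^ (-(η / 2)) * ‖u‖ ^ (-(1 + η / 2)) := by
        rw [div_eq_mul_inv, ← Real.rpow_neg_one ‖u‖, mul_assoc _ (‖u‖ ^ _), ← Real.rpow_add hpos]
        ring_nf
    _ ≤ 16 * (N₀ : ℝ) ^ (-(η / 2)) * ((2 / η) ^ (1 + η / 2) * (1 + ‖τ‖) ^ (-(1 + η / 2))) := by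
        gcongr
    _ = _ := by ring

theorem norm_mellin_trapezoid_le_of_re_le {N₀ N : ℕ} (h₀ : 0 < N₀) (h : N₀ < N) {u : ℂ}
    (hu : u.re ≤ 2) (him : u.im ≠ 0) :
    ‖mellin (trapezoid N₀ N) u‖ ≤ 4 * (N + 1 : ℝ) ^ 3 / u.im ^ 2 := by
  have hu0 : u ≠ 0 := by rintro rfl; simp at him
  have hu1 : u + 1 ≠ 0 := by
    intro h; have := congrArg Complex.im h; simp at this; exact him this
  rw [mellin_trapezoid h₀ h hu0 hu1, norm_div, norm_mul]
  have h1 := Complex.abs_im_le_norm u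
  have h2 := Complex.abs_im_le_norm (u + 1)
  simp only [Complex.add_im, Complex.one_im, add_zero] at h2
  have h3 : u.im ^ 2 ≤ ‖u‖ * ‖u + 1‖ := by
    rw [← sq_abs, sq]; gcongr
  have h4 : ‖powIncr N u - powIncr N₀ u‖ ≤ 4 * (N + 1 : ℝ) ^ 3 := by
    have q1 := norm_powIncr_le (h₀.trans h) (u := u) (r := 3) (by linarith) (by norm_num)
    have q2 := norm_powIncr_le h₀ (u := u) (r := 3) (by linarith) (by norm_num)
    have q3 : (N₀ + 1 : ℝ) ^ (3 : ℝ) ≤ (N + 1 : ℝ) ^ (3 : ℝ) := by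
      gcongr
    have q4 : (N + 1 : ℝ) ^ (3 : ℝ) = (N + 1 : ℝ) ^ 3 := by norm_cast
    rw [← q4]
    refine (norm_sub_le _ _).trans ?_
    linarith
  have : 0 < u.im ^ 2 := by positivity
  gcongr

theorem term_mul_cpow_neg (f : ℕ → ℂ) (s u : ℂ) (n : ℕ) :
    LSeries.term (fun n => f n * (n : ℂ) ^ (-s)) u n = LSeries.term f (s + u) n := by
  rcases eq_or_ne n 0 with rfl | hn
  · simp
  · rw [LSeries.term_eq_mul_cpow_neg _ _ hn, LSeries.term_eq_mul_cpow_neg _ _ hn, mul_assoc,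
      ← Complex.cpow_add _ _ (by exact_mod_cast hn), neg_add]

theorem tsum_mul_trapezoid (c : ℕ → ℂ) {N₀ N : ℕ} (h : N₀ ≤ N) :
    ∑' n : ℕ, c n * trapezoid N₀ N n = ∑ n ∈ Finset.Ioc N₀ N, c n := by
  rw [tsum_eq_sum (s := Finset.Ioc N₀ N)]
  · refine Finset.sum_congr rfl fun n hn => ?_
    rw [trapezoid_natCast _ _ _ h, if_pos hn, mul_one]
  · intro n hn
    rw [trapezoid_natCast _ _ _ h, if_neg hn, mul_zero]

theorem cube_div_sq_le_decay {M t m : ℝ} (hMt : M ^ 6 ≤ t) (htm : t ≤ 2 * m)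
    (hm : 1 ≤ m) : 4 * M ^ 3 / m ^ 2 ≤ 32 * (1 + m) ^ (-(3 / 2) : ℝ) := by
  obtain ⟨z, hz⟩ : ∃ z, z = Real.sqrt (1 + m) := ⟨_, rfl⟩
  have hzsq : z ^ 2 = 1 + m := by rw [hz]; exact Real.sq_sqrt (by linarith)
  have hz0 : 0 < z := by rw [hz]; exact Real.sqrt_pos.2 (by linarith)
  have e : (1 + m) ^ (-(3 / 2) : ℝ) = (z ^ 3)⁻¹ := by
    rw [Real.rpow_neg (by linarith), ← hzsq, ← Real.rpow_natCast, ← Real.rpow_natCast,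
      ← Real.rpow_mul hz0.le]
    norm_num
  have h1 : M ^ 3 ≤ 2 * z := by
    refine le_of_abs_le (abs_le_of_sq_le_sq ?_ (by positivity))
    nlinarith [show (M ^ 3) ^ 2 = M ^ 6 by ring]
  rw [e, ← div_eq_mul_inv, div_le_div_iff₀ (by positivity) (by positivity)]
  have h2 : z ^ 4 ≤ 4 * m ^ 2 := by
    rw [show z ^ 4 = (z ^ 2) ^ 2 by ring, hzsq]; nlinarith
  calc 4 * M ^ 3 * z ^ 3 ≤ 4 * (2 * z) * z ^ 3 := by gcongr
    _ = 8 * z ^ 4 := by ring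
    _ ≤ _ := by linarith

theorem exists_norm_sum_vonMangoldt_le
    (hRH : ∀ s : ℂ, 1 / 2 < s.re → 1 ≤ s.im → riemannZeta s ≠ 0) {η : ℝ} (hη : 0 < η)
    (hη' : η ≤ 1 / 4) :
    ∃ B G : ℝ, 0 ≤ B ∧ 0 ≤ G ∧ ∀ (s : ℂ) (N₀ N : ℕ), 0 < N₀ → 12 ≤ s.im → 1 / 2 + 2 * η ≤ s.re →
      s.re ≤ 2 → (N + 1 : ℝ) ^ 6 ≤ s.im →
      ‖∑ n ∈ Finset.Ioc N₀ N, (ArithmeticFunction.vonMangoldt n : ℂ) * (n : ℂ) ^ (-s)‖ ≤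
        B + G * (N₀ : ℝ) ^ (-(η / 2)) * Real.log s.im := by
  obtain ⟨C, hC, hCb⟩ := exists_norm_logDeriv_riemannZeta_le hRH hη (by linarith)
  obtain ⟨A, hA⟩ : ∃ A, A = ∑' n, ‖LSeries.term (fun n => (ArithmeticFunction.vonMangoldt n : ℂ)) 2 n‖ :=
    ⟨_, rfl⟩
  obtain ⟨J, hJ⟩ : ∃ J, J = ∫ τ : ℝ, (1 + ‖τ‖) ^ (-(1 + η / 2)) := ⟨_, rfl⟩
  obtain ⟨K, hK⟩ : ∃ K, K = 16 * (2 / η) ^ (1 + η / 2) := ⟨_, rfl⟩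
  have hA0 : 0 ≤ A := hA ▸ tsum_nonneg fun _ => norm_nonneg _
  have hJ0 : 0 ≤ J := hJ ▸ integral_nonneg fun _ => by positivity
  have hK0 : 0 < K := by rw [hK]; positivity
  have hI := decayIntegral_nonneg
  have hB0 : 0 ≤ A * 32 * decayIntegral + 2 * (32 * C) * (2 + η) :=
    add_nonneg (mul_nonneg (by positivity) hI) (by positivity)
  refine ⟨A * 32 * decayIntegral + 2 * (32 * C) * (2 + η), 2 * C * K * J, hB0, by positivity,
    fun s N₀ N hN₀ ht hs₁ hs₂ hN => ?_⟩
  obtain ⟨t, ht'⟩ : ∃ t, t = s.im := ⟨_, rfl⟩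
  rw [← ht'] at ht hN ⊢
  have hlog : 0 ≤ Real.log t := Real.log_nonneg (by linarith)
  rcases le_or_gt N N₀ with hle | hlt
  · rw [Finset.Ioc_eq_empty (by omega)]
    simp only [Finset.sum_empty, norm_zero]
    exact add_nonneg hB0 (by positivity)
  set D : ℂ → ℂ := fun u => -deriv riemannZeta (s + u) / riemannZeta (s + u) with hD
  have hM0 : (0 : ℝ) ≤ N + 1 := by positivity
  have hM3 : (N + 1 : ℝ) ^ 3 ≤ t := by
    refine le_trans ?_ hN
    exact pow_le_pow_right₀ (by linarith [(Nat.cast_nonneg N : (0:ℝ) ≤ N)]) (by norm_num)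
  have hzeta : ∀ u : ℂ, -η ≤ u.re → u.re ≤ 2 → -(t / 2) ≤ u.im → u.im ≤ t / 2 →
      DifferentiableAt ℂ D u ∧ ‖D u‖ ≤ 2 * C * Real.log t := by
    intro u h1 h2 h3 h4
    have hne1 : s + u ≠ 1 := by
      intro h; have := congrArg Complex.im h
      simp [← ht'] at this; linarith
    have hre : (s + u).re = s.re + u.re := rfl
    have him : (s + u).im = t + u.im := by simp [ht']
    have hne0 : riemannZeta (s + u) ≠ 0 := hRH _ (by rw [hre]; linarith) (by rw [him]; linarith)
    constructor
    · have hz : DifferentiableAt ℂ (fun u => riemannZeta (s + u)) u :=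
        (differentiableAt_riemannZeta hne1).comp u (by fun_prop)
      have hopen : DifferentiableOn ℂ riemannZeta {1}ᶜ := fun z hz =>
        (differentiableAt_riemannZeta hz).differentiableWithinAt
      have hz' : DifferentiableAt ℂ (fun u => deriv riemannZeta (s + u)) u :=
        ((hopen.deriv isOpen_compl_singleton).differentiableAt
          (isOpen_compl_singleton.mem_nhds hne1)).comp u (by fun_prop)
      exact hz'.neg.div hz hne0
    · have := hCb (s + u) (by rw [hre]; linarith) (by rw [hre]; linarith) (by rw [him]; linarith)
      simp only [hD, neg_div, norm_neg]
      refine this.trans ?_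
      have hl : Real.log (s + u).im ≤ 2 * Real.log t := by
        rw [him, ← Real.log_rpow (by linarith)]
        refine Real.log_le_log (by linarith) ?_
        norm_num
        nlinarith
      nlinarith
  have hedge : ∀ τ : ℝ, |τ| = t / 2 → ∀ σ ∈ Icc (-η) 2,
      ‖D (σ + τ * Complex.I) * mellin (trapezoid N₀ N) (σ + τ * Complex.I)‖ ≤ 32 * C := by
    intro τ hτ σ hσ
    have hre : (σ + τ * Complex.I : ℂ).re = σ := by simp
    have him : (σ + τ * Complex.I : ℂ).im = τ := by simp
    have hτ' := abs_le.1 hτ.le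
    have hD1 := (hzeta (σ + τ * Complex.I) (by rw [hre]; exact hσ.1) (by rw [hre]; exact hσ.2)
      (by rw [him]; exact hτ'.1) (by rw [him]; exact hτ'.2)).2
    have hW := norm_mellin_trapezoid_le_of_re_le hN₀ hlt (u := σ + τ * Complex.I)
      (by rw [hre]; exact hσ.2) (by rw [him]; rintro rfl; simp at hτ; linarith)
    rw [him, ← sq_abs, hτ] at hW
    rw [norm_mul]
    have hlt' : Real.log t ≤ t := (Real.log_le_sub_one_of_pos (by linarith)).trans (by linarith)
    calc _ ≤ (2 * C * Real.log t) * (4 * (N + 1 : ℝ) ^ 3 / (t / 2) ^ 2) := by gcongr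
      _ ≤ (2 * C * t) * (4 * t / (t / 2) ^ 2) := by gcongr
      _ = 32 * C := by field_simp; norm_num
  have hterm : ∀ τ : ℝ, LSeries (fun n => (ArithmeticFunction.vonMangoldt n : ℂ) * (n : ℂ) ^ (-s))
      ((2 : ℝ) + τ * Complex.I) = D ((2 : ℝ) + τ * Complex.I) := by
    intro τ
    have := ArithmeticFunction.LSeries_vonMangoldt_eq_deriv_riemannZeta_div
      (s := s + ((2 : ℝ) + τ * Complex.I)) (by simp; linarith)
    rw [hD]
    simp only
    rw [← this, LSeries, LSeries]
    simp only [term_mul_cpow_neg]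
  have hsum2 := (ArithmeticFunction.LSeriesSummable_vonMangoldt (s := 2) (by norm_num)).norm
  have hnle : ∀ n, ‖LSeries.term (fun n => (ArithmeticFunction.vonMangoldt n : ℂ) * (n : ℂ) ^ (-s))
      ((2 : ℝ) : ℂ) n‖ ≤ ‖LSeries.term (fun n => (ArithmeticFunction.vonMangoldt n : ℂ)) 2 n‖ := by
    intro n
    rw [term_mul_cpow_neg]
    exact LSeries.norm_term_le_of_re_le_re _ (by simp; linarith) n
  have hsumN := hsum2.of_nonneg_of_le (fun _ => norm_nonneg _) hnle
  have key := norm_tsum_mul_le_of_mellin (a := fun n => (ArithmeticFunction.vonMangoldt n : ℂ) * (n : ℂ) ^ (-s))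
    (D := D) (w := trapezoid N₀ N) (α := N₀) (β := N + 1) (σ₁ := -η) (σ₂ := 2) (t₁ := -(t / 2))
    (t₂ := t / 2) (E := 32) (E' := 32 * C) (by exact_mod_cast hN₀) (continuous_trapezoid _ _)
    (fun v hv => trapezoid_eq_zero hlt.le hv) (by linarith) (by linarith) hsumN.of_norm
    (fun τ => (hterm τ).symm) (fun u h1 h2 h3 h4 => (hzeta u h1 h2 h3 h4).1) ?_
    (hedge _ (by rw [abs_neg, abs_of_pos]; linarith)) (hedge _ (by rw [abs_of_pos]; linarith))
  · rw [tsum_mul_trapezoid _ hlt.le] at key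
    refine key.trans ?_
    have hA' : ∑' n, ‖LSeries.term (fun n => (ArithmeticFunction.vonMangoldt n : ℂ) * (n : ℂ) ^ (-s))
      ((2 : ℝ) : ℂ) n‖ ≤ A := hA ▸ hsumN.tsum_le_tsum hnle hsum2
    have hInt : ∫ τ in -(t / 2)..(t / 2), ‖D ((-η : ℝ) + τ * Complex.I) *
        mellin (trapezoid N₀ N) ((-η : ℝ) + τ * Complex.I)‖ ≤
        2 * C * K * J * (N₀ : ℝ) ^ (-(η / 2)) * Real.log t := by
      have hgi : Integrable fun τ : ℝ => 2 * C * Real.log t * (K * (N₀ : ℝ) ^ (-(η / 2))) *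
          (1 + ‖τ‖) ^ (-(1 + η / 2)) :=
        (integrable_one_add_norm (by simp; positivity)).const_mul _
      rw [intervalIntegral.integral_of_le (by linarith)]
      calc _ ≤ ∫ τ in Ioc (-(t / 2)) (t / 2), 2 * C * Real.log t * (K * (N₀ : ℝ) ^ (-(η / 2))) *
              (1 + ‖τ‖) ^ (-(1 + η / 2)) := by
            refine integral_mono_of_nonneg (Eventually.of_forall fun _ => norm_nonneg _)
              hgi.integrableOn ?_
            filter_upwards [ae_restrict_mem measurableSet_Ioc] with τ hτ
            rw [norm_mul, mul_assoc (2 * C * Real.log t)]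
            refine mul_le_mul (hzeta _ ?_ ?_ ?_ ?_).2 ?_ (norm_nonneg _) (by positivity)
            · simp
            · simp; linarith
            · simpa using hτ.1.le
            · simpa using hτ.2
            · rw [hK]; exact norm_mellin_trapezoid_le_left hN₀ hlt hη hη' τ
        _ ≤ ∫ τ : ℝ, 2 * C * Real.log t * (K * (N₀ : ℝ) ^ (-(η / 2))) *
              (1 + ‖τ‖) ^ (-(1 + η / 2)) :=
            setIntegral_le_integral hgi (Eventually.of_forall fun _ => by positivity)
        _ = _ := by rw [integral_const_mul, ← hJ]; ring
    have : (∑' n, ‖LSeries.term (fun n => (ArithmeticFunction.vonMangoldt n : ℂ) * (n : ℂ) ^ (-s))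
      ((2 : ℝ) : ℂ) n‖) * 32 * decayIntegral ≤ A * 32 * decayIntegral := by gcongr
    linarith
  · intro τ hτ
    have hτ' : t / 2 < |τ| := by
      rw [mem_Icc, ← abs_le, not_le] at hτ; exact hτ
    have hW := norm_mellin_trapezoid_le_of_re_le hN₀ hlt (u := (2 : ℝ) + τ * Complex.I)
      (by simp) (by simp; rintro rfl; simp at hτ'; linarith)
    refine hW.trans ?_
    have him : ((2 : ℝ) + τ * Complex.I : ℂ).im = τ := by simp
    rw [him, ← sq_abs, Real.norm_eq_abs]
    exact cube_div_sq_le_decay hN (by linarith) (by linarith)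

theorem norm_sum_smul_le_of_antitone {b : ℕ → ℝ} (hb : Antitone b) (hb0 : ∀ i, 0 ≤ b i) (c : ℕ → ℂ)
    {P : ℝ} (n : ℕ) (hP : ∀ m ≤ n, ‖∑ i ∈ Finset.range m, c i‖ ≤ P) :
    ‖∑ i ∈ Finset.range n, b i • c i‖ ≤ b 0 * P := by
  rw [Finset.sum_range_by_parts]
  have h1 : ‖b (n - 1) • ∑ i ∈ Finset.range n, c i‖ ≤ b (n - 1) * P := by
    rw [norm_smul, Real.norm_of_nonneg (hb0 _)]
    exact mul_le_mul_of_nonneg_left (hP n le_rfl) (hb0 _)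
  have h2 : ‖∑ i ∈ Finset.range (n - 1), (b (i + 1) - b i) • ∑ i ∈ Finset.range (i + 1), c i‖ ≤
      ∑ i ∈ Finset.range (n - 1), (b i - b (i + 1)) * P := by
    refine norm_sum_le_of_le _ fun i hi => ?_
    have hle : b (i + 1) ≤ b i := hb (Nat.le_succ i)
    rw [Finset.mem_range] at hi
    rw [norm_smul, Real.norm_of_nonpos (by linarith), neg_sub]
    exact mul_le_mul_of_nonneg_left (hP _ (by omega)) (by linarith)
  rw [← Finset.sum_mul, Finset.sum_range_sub'] at h2
  refine (norm_sub_le _ _).trans ?_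
  linarith

theorem summable_vonMangoldt_not_prime {σ : ℝ} (hσ : 1 / 2 < σ) :
    Summable fun n : ℕ => (if n.Prime then 0 else ArithmeticFunction.vonMangoldt n) * (n : ℝ) ^ (-σ) := by
  obtain ⟨C, hC⟩ := Chebyshev.psi_sub_theta_le_mul_sqrt
  have hnn : ∀ n : ℕ, 0 ≤ (if n.Prime then 0 else ArithmeticFunction.vonMangoldt n) := fun n => by
    split_ifs
    · exact le_rfl
    · exact ArithmeticFunction.vonMangoldt_nonneg
  have h := LSeriesSummable_of_sum_norm_bigO_and_nonneg (r := 1 / 2) (s := σ)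
    (f := fun n : ℕ => if n.Prime then 0 else ArithmeticFunction.vonMangoldt n) ?_ hnn (by norm_num)
    (by simpa using hσ)
  · refine h.norm.congr fun n => ?_
    rcases eq_or_ne n 0 with rfl | hn
    · simp
    · have hn' : (0 : ℝ) < n := by positivity
      rw [LSeries.term_eq_mul_cpow_neg _ _ hn, norm_mul, Complex.norm_real,
        Real.norm_of_nonneg (hnn n), ← Complex.ofReal_natCast,
        Complex.norm_cpow_eq_rpow_re_of_pos hn']
      simp
  · refine Asymptotics.IsBigO.of_bound C (Eventually.of_forall fun n => ?_)
    have h1 := hC n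
    rw [Chebyshev.psi_sub_theta_eq_sum_not_prime, Nat.floor_natCast, Finset.sum_filter,
      Real.sqrt_eq_rpow] at h1
    rw [Real.norm_of_nonneg (Finset.sum_nonneg fun n _ => hnn n), Real.norm_of_nonneg (by positivity)]
    refine le_trans (le_of_eq ?_) h1
    refine Finset.sum_congr (by ext; simp; omega) fun k _ => ?_
    split_ifs <;> rfl

theorem norm_natCast_cpow_neg {n : ℕ} (hn : 0 < n) (s : ℂ) : ‖(n : ℂ) ^ (-s)‖ = (n : ℝ) ^ (-s.re) := by
  rw [← Complex.ofReal_natCast, Complex.norm_cpow_eq_rpow_re_of_pos (by exact_mod_cast hn)]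
  simp

theorem sum_Ioc_eq_sum_range (f : ℕ → ℂ) (N₀ M : ℕ) :
    ∑ n ∈ Finset.Ioc N₀ M, f n = ∑ i ∈ Finset.range (M - N₀), f (N₀ + 1 + i) := by
  have : Finset.Ioc N₀ M = Finset.Ico (N₀ + 1) (M + 1) := by ext; simp
  rw [this, Finset.sum_Ico_eq_sum_range]
  congr 2
  omega

theorem exists_norm_sum_prime_cpow_le
    (hRH : ∀ s : ℂ, 1 / 2 < s.re → 1 ≤ s.im → riemannZeta s ≠ 0) {η : ℝ} (hη : 0 < η)
    (hη' : η ≤ 1 / 4) :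
    ∃ B G : ℝ, 0 ≤ B ∧ 0 ≤ G ∧ ∀ (s : ℂ) (N₀ N : ℕ), 0 < N₀ → 12 ≤ s.im → 1 / 2 + 2 * η ≤ s.re →
      s.re ≤ 2 → (N + 1 : ℝ) ^ 6 ≤ s.im →
      ‖∑ n ∈ Finset.Ioc N₀ N, if n.Prime then (n : ℂ) ^ (-s) else 0‖ ≤
        B + G * (N₀ : ℝ) ^ (-(η / 2)) * Real.log s.im := by
  obtain ⟨B, G, hB, hG, hBG⟩ := exists_norm_sum_vonMangoldt_le hRH hη hη'
  have hsum := summable_vonMangoldt_not_prime (σ := 1 / 2 + 2 * η) (by linarith)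
  obtain ⟨S, hS⟩ : ∃ S, S = ∑' n : ℕ, (if n.Prime then 0 else ArithmeticFunction.vonMangoldt n) *
    (n : ℝ) ^ (-(1 / 2 + 2 * η)) := ⟨_, rfl⟩
  have hnn : ∀ n : ℕ, 0 ≤ (if n.Prime then 0 else ArithmeticFunction.vonMangoldt n) *
      (n : ℝ) ^ (-(1 / 2 + 2 * η)) := fun n => by
    refine mul_nonneg ?_ (by positivity)
    split_ifs
    · exact le_rfl
    · exact ArithmeticFunction.vonMangoldt_nonneg
  have hS0 : 0 ≤ S := hS ▸ tsum_nonneg hnn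
  refine ⟨2 * (B + S), 2 * G, by positivity, by positivity, fun s N₀ N hN₀ ht hs₁ hs₂ hN => ?_⟩
  have hlog : 0 ≤ Real.log s.im := Real.log_nonneg (by linarith)
  set P : ℝ := B + G * (N₀ : ℝ) ^ (-(η / 2)) * Real.log s.im + S with hP
  have hP0 : 0 ≤ P := by positivity
  have hpart : ∀ M ≤ N, ‖∑ n ∈ Finset.Ioc N₀ M, if n.Prime then
      (ArithmeticFunction.vonMangoldt n : ℂ) * (n : ℂ) ^ (-s) else 0‖ ≤ P := by
    intro M hM
    have h1 := hBG s N₀ M hN₀ ht hs₁ hs₂ (le_trans (by gcongr) hN)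
    have h2 : ‖∑ n ∈ Finset.Ioc N₀ M, if n.Prime then 0 else
        (ArithmeticFunction.vonMangoldt n : ℂ) * (n : ℂ) ^ (-s)‖ ≤ S := by
      rw [hS]
      refine (norm_sum_le_of_le (f := fun n : ℕ => (if n.Prime then 0 else
        (ArithmeticFunction.vonMangoldt n : ℂ) * (n : ℂ) ^ (-s))) _ fun n hn => ?_).trans
        (hsum.sum_le_tsum (Finset.Ioc N₀ M) fun n _ => hnn n)
      rw [Finset.mem_Ioc] at hn
      split_ifs
      · simp
      · rw [norm_mul, norm_natCast_cpow_neg (by omega), Complex.norm_real,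
          Real.norm_of_nonneg ArithmeticFunction.vonMangoldt_nonneg]
        gcongr
        exact_mod_cast (by omega : 1 ≤ n)
    have e : (∑ n ∈ Finset.Ioc N₀ M, if n.Prime then
        (ArithmeticFunction.vonMangoldt n : ℂ) * (n : ℂ) ^ (-s) else 0) =
        (∑ n ∈ Finset.Ioc N₀ M, (ArithmeticFunction.vonMangoldt n : ℂ) * (n : ℂ) ^ (-s)) -
        ∑ n ∈ Finset.Ioc N₀ M, if n.Prime then 0 else
          (ArithmeticFunction.vonMangoldt n : ℂ) * (n : ℂ) ^ (-s) := by
      rw [← Finset.sum_sub_distrib]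
      refine Finset.sum_congr rfl fun n _ => ?_
      split_ifs <;> simp
    rw [e, hP]
    exact (norm_sub_le _ _).trans (add_le_add h1 h2)
  set b : ℕ → ℝ := fun i => (Real.log (N₀ + 1 + i : ℕ))⁻¹ with hb
  have hN₀' : (1 : ℝ) ≤ N₀ := by exact_mod_cast hN₀
  have hlog2 : ∀ i : ℕ, Real.log 2 ≤ Real.log (N₀ + 1 + i : ℕ) := fun i => by
    refine Real.log_le_log (by norm_num) ?_
    exact_mod_cast (by omega : 2 ≤ N₀ + 1 + i)
  have hl2 : (0.69 : ℝ) < Real.log 2 := by linarith [Real.log_two_gt_d9]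
  have hanti : Antitone b := by
    intro i j hij
    simp only [hb]
    have := hlog2 i
    gcongr
    · linarith
  have hb0 : ∀ i, 0 ≤ b i := fun i => by
    have := hlog2 i
    simp only [hb]
    exact inv_nonneg.2 (by linarith)
  have hb2 : b 0 ≤ 2 := by
    simp only [hb]
    rw [inv_le_comm₀ (by linarith [hlog2 0]) (by norm_num)]
    linarith [hlog2 0]
  have key := norm_sum_smul_le_of_antitone hanti hb0 (P := P)
    (fun i => if (N₀ + 1 + i).Prime then
      (ArithmeticFunction.vonMangoldt (N₀ + 1 + i) : ℂ) * ((N₀ + 1 + i : ℕ) : ℂ) ^ (-s) else 0)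
    (N - N₀) (fun m hm => by
      rcases Nat.eq_zero_or_pos m with rfl | hm0
      · simpa using hP0
      · have := hpart (N₀ + m) (by omega)
        rw [sum_Ioc_eq_sum_range, Nat.add_sub_cancel_left] at this
        exact this)
  rw [sum_Ioc_eq_sum_range]
  have e : ∀ i ∈ Finset.range (N - N₀),
      (if (N₀ + 1 + i).Prime then ((N₀ + 1 + i : ℕ) : ℂ) ^ (-s) else 0) = b i • (if (N₀ + 1 + i).Prime then
      (ArithmeticFunction.vonMangoldt (N₀ + 1 + i) : ℂ) * ((N₀ + 1 + i : ℕ) : ℂ) ^ (-s) else 0) := by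
    intro i _
    split_ifs with h
    · have h0 : Real.log (N₀ + 1 + i : ℕ) ≠ 0 := by linarith [hlog2 i]
      rw [ArithmeticFunction.vonMangoldt_apply_prime h, hb, Complex.real_smul, ← mul_assoc,
        ← Complex.ofReal_mul, inv_mul_cancel₀ h0, Complex.ofReal_one, one_mul]
    · simp
  rw [Finset.sum_congr rfl e]
  refine key.trans ((mul_le_mul_of_nonneg_right hb2 hP0).trans (le_of_eq ?_))
  rw [hP]; ring

theorem norm_inv_one_sub_le_exp {z : ℂ} (hz : ‖z‖ ≤ 3 / 4) :
    ‖(1 - z)⁻¹‖ ≤ Real.exp (z.re + 2 * ‖z‖ ^ 2) := by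
  have hz' : ‖-z‖ < 1 := by rw [norm_neg]; linarith
  have h := Complex.norm_log_one_add_sub_self_le hz'
  rw [norm_neg, ← sub_eq_add_neg, sub_neg_eq_add] at h
  have h1 : (1 - ‖z‖)⁻¹ ≤ 4 := by
    rw [inv_le_comm₀ (by linarith) (by norm_num)]; linarith
  have h2 := (Complex.abs_re_le_norm _).trans h
  rw [Complex.add_re, Complex.log_re] at h2
  have h3 := neg_le_of_abs_le h2
  have hne : 1 - z ≠ 0 := by
    intro h0
    have : z = 1 := by linear_combination -h0
    rw [this] at hz; norm_num at hz
  have hpos : 0 < ‖1 - z‖ := norm_pos_iff.2 hne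
  rw [norm_inv, ← Real.exp_log hpos, ← Real.exp_neg, Real.exp_le_exp]
  have : ‖z‖ ^ 2 * (1 - ‖z‖)⁻¹ ≤ ‖z‖ ^ 2 * 4 := by gcongr
  linarith

/-- Under the Riemann hypothesis, truncated Euler products are small to the right of the critical
line at height polynomially large in the length of the product. -/
theorem exists_norm_prod_primesBelow_le
    (hRH : ∀ s : ℂ, 1 / 2 < s.re → 1 ≤ s.im → riemannZeta s ≠ 0) {η ε : ℝ} (hη : 0 < η)
    (hη' : η ≤ 1 / 4) (hε : 0 < ε) :
    ∃ C : ℝ, 0 < C ∧ ∀ (s : ℂ) (N : ℕ), 12 ≤ s.im → 1 / 2 + 2 * η ≤ s.re → s.re ≤ 2 → 0 < N →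
      (N : ℝ) ^ 6 ≤ s.im → ‖∏ p ∈ N.primesBelow, (1 - (p : ℂ) ^ (-s))⁻¹‖ ≤ C * s.im ^ ε := by
  obtain ⟨B, G, hB, hG, hBG⟩ := exists_norm_sum_prime_cpow_le hRH hη hη'
  have htend : Tendsto (fun n : ℕ => G * (n : ℝ) ^ (-(η / 2))) atTop (𝓝 (G * 0)) :=
    ((tendsto_rpow_neg_atTop (half_pos hη)).comp tendsto_natCast_atTop_atTop).const_mul G
  rw [mul_zero] at htend
  obtain ⟨N₀, hN₀ε, hN₀⟩ := ((htend.eventually_le_const hε).and (eventually_gt_atTop 0)).exists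
  have hsum : Summable fun n : ℕ => (n : ℝ) ^ (-(1 + 4 * η)) :=
    Real.summable_nat_rpow.2 (by linarith)
  obtain ⟨S, hS⟩ : ∃ S, S = ∑' n : ℕ, (n : ℝ) ^ (-(1 + 4 * η)) := ⟨_, rfl⟩
  refine ⟨Real.exp (N₀ + B + 2 * S), Real.exp_pos _, fun s N ht hs₁ hs₂ hN hNt => ?_⟩
  have hlog : 0 ≤ Real.log s.im := Real.log_nonneg (by linarith)
  have hterm1 : ∀ n : ℕ, ‖if n.Prime then (n : ℂ) ^ (-s) else 0‖ ≤ 1 := by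
    intro n
    split_ifs with h
    · rw [norm_natCast_cpow_neg h.pos]
      exact Real.rpow_le_one_of_one_le_of_nonpos (by exact_mod_cast h.one_le) (by linarith)
    · simp
  have hprimes : ‖∑ p ∈ N.primesBelow, (p : ℂ) ^ (-s)‖ ≤ N₀ + B + ε * Real.log s.im := by
    have e : ∑ p ∈ N.primesBelow, (p : ℂ) ^ (-s) =
        ∑ n ∈ Finset.Ioc 0 (N - 1), if n.Prime then (n : ℂ) ^ (-s) else 0 := by
      rw [← Finset.sum_filter]
      refine Finset.sum_congr ?_ fun _ _ => rfl
      ext p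
      simp only [Nat.mem_primesBelow, Finset.mem_filter, Finset.mem_Ioc]
      constructor
      · rintro ⟨h1, h2⟩; exact ⟨⟨h2.pos, by omega⟩, h2⟩
      · rintro ⟨⟨_, h1⟩, h2⟩; exact ⟨by omega, h2⟩
    rw [e]
    have htriv : ∀ M : ℕ, ‖∑ n ∈ Finset.Ioc 0 M, if n.Prime then (n : ℂ) ^ (-s) else 0‖ ≤ M := by
      intro M
      refine (norm_sum_le_of_le _ fun n _ => hterm1 n).trans (by simp)
    have hεl : 0 ≤ ε * Real.log s.im := by positivity
    rcases le_or_gt (N - 1) N₀ with hle | hlt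
    · have : ((N - 1 : ℕ) : ℝ) ≤ N₀ := by exact_mod_cast hle
      linarith [htriv (N - 1)]
    · rw [← Finset.sum_Ioc_consecutive _ (Nat.zero_le N₀) hlt.le]
      refine (norm_add_le _ _).trans ?_
      have h1 := hBG s N₀ (N - 1) hN₀ ht hs₁ hs₂ (by
        rw [← Nat.cast_add_one, Nat.sub_add_cancel hN]; exact hNt)
      have h2 : G * (N₀ : ℝ) ^ (-(η / 2)) * Real.log s.im ≤ ε * Real.log s.im := by gcongr
      linarith [htriv N₀]
  have hsq : ∑ p ∈ N.primesBelow, 2 * ‖(p : ℂ) ^ (-s)‖ ^ 2 ≤ 2 * S := by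
    rw [← Finset.mul_sum, hS]
    gcongr
    refine (Finset.sum_le_sum fun p hp => ?_).trans
      (hsum.sum_le_tsum N.primesBelow fun n _ => by positivity)
    have hp := Nat.prime_of_mem_primesBelow hp
    rw [norm_natCast_cpow_neg hp.pos, ← Real.rpow_natCast, ← Real.rpow_mul (by positivity)]
    refine Real.rpow_le_rpow_of_exponent_le (by exact_mod_cast hp.one_le) ?_
    push_cast; linarith
  rw [norm_prod]
  calc ∏ p ∈ N.primesBelow, ‖(1 - (p : ℂ) ^ (-s))⁻¹‖
      ≤ ∏ p ∈ N.primesBelow, Real.exp (((p : ℂ) ^ (-s)).re + 2 * ‖(p : ℂ) ^ (-s)‖ ^ 2) := by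
        refine Finset.prod_le_prod (fun _ _ => norm_nonneg _) fun p hp => ?_
        have hp := Nat.prime_of_mem_primesBelow hp
        refine norm_inv_one_sub_le_exp ?_
        rw [norm_natCast_cpow_neg hp.pos]
        have h2p : (2 : ℝ) ≤ p := by exact_mod_cast hp.two_le
        calc (p : ℝ) ^ (-s.re) ≤ (p : ℝ) ^ (-(1 / 2) : ℝ) :=
              Real.rpow_le_rpow_of_exponent_le (by linarith) (by linarith)
          _ ≤ 2 ^ (-(1 / 2) : ℝ) :=
              Real.rpow_le_rpow_of_nonpos (by norm_num) h2p (by norm_num)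
          _ = (Real.sqrt 2)⁻¹ := by rw [Real.rpow_neg (by norm_num), Real.sqrt_eq_rpow]
          _ ≤ 3 / 4 := by
              rw [inv_le_comm₀ (by positivity) (by norm_num)]
              exact Real.le_sqrt_of_sq_le (by norm_num)
    _ = Real.exp ((∑ p ∈ N.primesBelow, (p : ℂ) ^ (-s)).re +
          ∑ p ∈ N.primesBelow, 2 * ‖(p : ℂ) ^ (-s)‖ ^ 2) := by
        rw [← Real.exp_sum, Finset.sum_add_distrib, Complex.re_sum]
    _ ≤ Real.exp ((N₀ + B + 2 * S) + Real.log s.im * ε) := by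
        rw [Real.exp_le_exp]
        have := (Complex.re_le_norm _).trans hprimes
        linarith
    _ = _ := by
        rw [Real.exp_add, Real.rpow_def_of_pos (by linarith)]

/-- The function `v ^ s * e(-l v)`. -/
def oscKernel (s : ℂ) (l v : ℝ) : ℂ :=
  Complex.exp (s * (Real.log v : ℝ) - (2 * Real.pi * l * v : ℝ) * Complex.I)

/-- The logarithmic derivative of `oscKernel s l`, multiplied by `v`. -/
def oscPhase (s : ℂ) (l v : ℝ) : ℂ := s - (2 * Real.pi * l * v : ℝ) * Complex.I

theorem hasDerivAt_oscPhase (s : ℂ) (l v : ℝ) :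
    HasDerivAt (oscPhase s l) (-(2 * Real.pi * l * Complex.I)) v := by
  have h : HasDerivAt (fun v : ℝ => 2 * Real.pi * l * v) (2 * Real.pi * l) v := by
    simpa using (hasDerivAt_id v).const_mul (2 * Real.pi * l)
  refine ((h.ofReal_comp.mul_const Complex.I).const_sub s).congr_deriv ?_
  push_cast; ring

theorem hasDerivAt_oscKernel (s : ℂ) (l : ℝ) {v : ℝ} (hv : 0 < v) :
    HasDerivAt (oscKernel s l) (oscPhase s l v / v * oscKernel s l v) v := by
  have h : HasDerivAt (fun v : ℝ => 2 * Real.pi * l * v) (2 * Real.pi * l) v := by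
    simpa using (hasDerivAt_id v).const_mul (2 * Real.pi * l)
  refine ((((Real.hasDerivAt_log hv.ne').ofReal_comp.const_mul s).sub
    (h.ofReal_comp.mul_const Complex.I)).cexp).congr_deriv ?_
  have : (v : ℂ) ≠ 0 := by exact_mod_cast hv.ne'
  simp only [oscPhase, oscKernel, Pi.sub_apply]
  push_cast
  field_simp

theorem norm_oscKernel (s : ℂ) (l : ℝ) {v : ℝ} (hv : 0 < v) :
    ‖oscKernel s l v‖ = v ^ s.re := by
  rw [oscKernel, Complex.norm_exp, Real.rpow_def_of_pos hv]
  congr 1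
  simp [mul_comm]

/-- The oscillatory integral with amplitude `A` damped by a power of the phase derivative. -/
def oscIntegral (a b : ℝ) (A : ℝ → ℂ) (j : ℕ) (s : ℂ) (l : ℝ) : ℂ :=
  ∫ v in a..b, A v * (oscPhase s l v ^ j)⁻¹ * oscKernel s l v

section

variable {a b : ℝ} {A : ℝ → ℂ} {s : ℂ} {l : ℝ}

theorem oscIntegral_eq (ha : 0 < a) (hab : a < b) (hA : ContDiff ℝ (⊤ : ℕ∞) A)
    (hsupp : tsupport A ⊆ Ioo a b) (j : ℕ) (hne : ∀ v ∈ Icc a b, oscPhase s l v ≠ 0) :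
    oscIntegral a b A j s l =
      -oscIntegral a b (deriv fun v => (v : ℂ) * A v) (j + 1) s l -
        (j + 1) * (2 * Real.pi * l * Complex.I) *
          oscIntegral a b (fun v => (v : ℂ) * A v) (j + 2) s l := by
  have hB : ContDiff ℝ (⊤ : ℕ∞) fun v : ℝ => (v : ℂ) * A v :=
    Complex.ofRealCLM.contDiff.mul hA
  have hB' : Differentiable ℝ fun v : ℝ => (v : ℂ) * A v := hB.differentiable (by simp)
  have hdB : Continuous (deriv fun v : ℝ => (v : ℂ) * A v) := hB.continuous_deriv (by simp)
  have hAz : ∀ v, v ∉ Ioo a b → A v = 0 := fun v hv =>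
    image_eq_zero_of_notMem_tsupport fun h => hv (hsupp h)
  have hcg : ∀ n : ℕ, ContinuousOn (fun v => (oscPhase s l v ^ n)⁻¹) (uIcc a b) := fun n v hv => by
    rw [uIcc_of_le hab.le] at hv
    exact (((hasDerivAt_oscPhase s l v).continuousAt.pow n).inv₀
      (pow_ne_zero _ (hne v hv))).continuousWithinAt
  have hcE : ContinuousOn (oscKernel s l) (uIcc a b) := fun v hv => by
    rw [uIcc_of_le hab.le] at hv
    exact (hasDerivAt_oscKernel s l (ha.trans_le hv.1)).continuousAt.continuousWithinAt
  have hcP : ContinuousOn (oscPhase s l) (uIcc a b) := fun v _ =>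
    (hasDerivAt_oscPhase s l v).continuousAt.continuousWithinAt
  have hcv : ContinuousOn (fun v : ℝ => (v : ℂ)) (uIcc a b) :=
    Complex.continuous_ofReal.continuousOn
  have hu : ∀ v ∈ uIcc a b, HasDerivAt (fun v : ℝ => (v : ℂ) * A v * (oscPhase s l v ^ (j + 1))⁻¹)
      (deriv (fun v : ℝ => (v : ℂ) * A v) v * (oscPhase s l v ^ (j + 1))⁻¹ +
        (j + 1) * (2 * Real.pi * l * Complex.I) * ((v : ℂ) * A v * (oscPhase s l v ^ (j + 2))⁻¹)) v := by
    intro v hv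
    rw [uIcc_of_le hab.le] at hv
    have h0 := hne v hv
    refine ((hB' v).hasDerivAt.mul (((hasDerivAt_oscPhase s l v).pow (j + 1)).inv
      (pow_ne_zero _ h0))).congr_deriv ?_
    simp only [Pi.pow_apply, Pi.inv_apply, Nat.add_sub_cancel]
    push_cast
    field_simp
    ring
  have hi1 : ContinuousOn (fun v : ℝ => deriv (fun v : ℝ => (v : ℂ) * A v) v *
      (oscPhase s l v ^ (j + 1))⁻¹) (uIcc a b) := hdB.continuousOn.mul (hcg _)
  have hi2 : ContinuousOn (fun v : ℝ => (j + 1) * (2 * Real.pi * l * Complex.I) *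
      ((v : ℂ) * A v * (oscPhase s l v ^ (j + 2))⁻¹)) (uIcc a b) :=
    continuousOn_const.mul (hB.continuous.continuousOn.mul (hcg _))
  have hi3 : ContinuousOn (fun v : ℝ => oscPhase s l v / v * oscKernel s l v) (uIcc a b) := by
    refine (hcP.div hcv fun v hv => ?_).mul hcE
    rw [uIcc_of_le hab.le] at hv
    exact_mod_cast (ha.trans_le hv.1).ne'
  have key := intervalIntegral.integral_mul_deriv_eq_deriv_mul hu
    (fun v hv => hasDerivAt_oscKernel s l (ha.trans_le (by rw [uIcc_of_le hab.le] at hv; exact hv.1)))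
    (hi1.add hi2).intervalIntegrable hi3.intervalIntegrable
  rw [hAz a (by simp), hAz b (by simp)] at key
  simp only [mul_zero, zero_mul, sub_self, zero_sub] at key
  have e : oscIntegral a b A j s l = ∫ v in a..b, (v : ℂ) * A v * (oscPhase s l v ^ (j + 1))⁻¹ *
      (oscPhase s l v / v * oscKernel s l v) := by
    refine intervalIntegral.integral_congr fun v hv => ?_
    rw [uIcc_of_le hab.le] at hv
    have h0 := hne v hv
    have hv0 : (v : ℂ) ≠ 0 := by exact_mod_cast (ha.trans_le hv.1).ne'
    field_simp
    ring
  have i1 : IntervalIntegrable (fun v : ℝ => deriv (fun v : ℝ => (v : ℂ) * A v) v *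
      (oscPhase s l v ^ (j + 1))⁻¹ * oscKernel s l v) volume a b :=
    (hi1.mul hcE).intervalIntegrable
  have i2 : IntervalIntegrable (fun v : ℝ => (j + 1) * (2 * Real.pi * l * Complex.I) *
      ((v : ℂ) * A v * (oscPhase s l v ^ (j + 2))⁻¹ * oscKernel s l v)) volume a b :=
    (continuousOn_const.mul
      ((hB.continuous.continuousOn.mul (hcg _)).mul hcE)).intervalIntegrable
  rw [e, key, oscIntegral, oscIntegral, ← intervalIntegral.integral_const_mul, ← neg_add',
    ← intervalIntegral.integral_add i1 i2]
  congr 1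
  refine intervalIntegral.integral_congr fun v _ => ?_
  ring

theorem exists_norm_oscIntegral_le (ha : 0 < a) (hab : a < b) {M : ℝ} (hM : 0 ≤ M) (K : ℕ) :
    ∀ (A : ℝ → ℂ), ContDiff ℝ (⊤ : ℕ∞) A → tsupport A ⊆ Ioo a b → ∀ j : ℕ,
      ∃ C : ℝ, 0 ≤ C ∧ ∀ (s : ℂ) (l L : ℝ), 0 ≤ s.re → s.re ≤ 2 → 0 ≤ l → 0 < L → l ≤ M * L →
        (∀ v ∈ Icc a b, L ≤ ‖oscPhase s l v‖) → ‖oscIntegral a b A j s l‖ ≤ C * (L ^ (j + K))⁻¹ := by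
  induction K with
  | zero =>
    intro A hA hsupp j
    obtain ⟨C, hC⟩ := (isCompact_Icc (a := a) (b := b)).exists_bound_of_continuousOn
      hA.continuous.continuousOn
    have hC0 : 0 ≤ C := (norm_nonneg _).trans (hC a ⟨le_rfl, hab.le⟩)
    refine ⟨C * max 1 b ^ 2 * (b - a), by have := sub_pos.2 hab; positivity,
      fun s l L hs₁ hs₂ hl hL hlL hg => ?_⟩
    have := intervalIntegral.norm_integral_le_of_norm_le_const (a := a) (b := b)
      (C := C * (L ^ j)⁻¹ * max 1 b ^ 2)
      (f := fun v => A v * (oscPhase s l v ^ j)⁻¹ * oscKernel s l v) fun v hv => ?_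
    · rw [abs_of_pos (sub_pos.2 hab)] at this
      exact this.trans (le_of_eq (by rw [add_zero]; ring))
    · rw [uIoc_of_le hab.le] at hv
      have hv' : v ∈ Icc a b := ⟨hv.1.le, hv.2⟩
      have hv0 : 0 < v := ha.trans hv.1
      rw [norm_mul, norm_mul, norm_inv, norm_pow, norm_oscKernel _ _ hv0]
      have h1 : v ^ s.re ≤ max 1 b ^ 2 := by
        calc v ^ s.re ≤ (max 1 b) ^ s.re :=
              Real.rpow_le_rpow hv0.le (hv.2.trans (le_max_right _ _)) hs₁
          _ ≤ (max 1 b) ^ (2 : ℝ) := Real.rpow_le_rpow_of_exponent_le (le_max_left _ _) hs₂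
          _ = _ := by norm_cast
      have h2 := hg v hv'
      have h3 := hC v hv'
      gcongr
  | succ K ih =>
    intro A hA hsupp j
    have hB : ContDiff ℝ (⊤ : ℕ∞) fun v : ℝ => (v : ℂ) * A v :=
      Complex.ofRealCLM.contDiff.mul hA
    have hBs : tsupport (fun v : ℝ => (v : ℂ) * A v) ⊆ Ioo a b :=
      tsupport_mul_subset_right.trans hsupp
    obtain ⟨C₁, hC₁, h₁⟩ := ih (deriv fun v : ℝ => (v : ℂ) * A v) (hB.deriv' )
      ((tsupport_deriv_subset (𝕜 := ℝ)).trans hBs) (j + 1)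
    obtain ⟨C₂, hC₂, h₂⟩ := ih (fun v : ℝ => (v : ℂ) * A v) hB hBs (j + 2)
    refine ⟨C₁ + (j + 1) * (2 * Real.pi * M) * C₂, by positivity,
      fun s l L hs₁ hs₂ hl hL hlL hg => ?_⟩
    rw [oscIntegral_eq ha hab hA hsupp j fun v hv h0 => by
      have := hg v hv; rw [h0, norm_zero] at this; linarith]
    refine (norm_sub_le _ _).trans ?_
    rw [norm_neg, norm_mul]
    have e : ‖((j : ℂ) + 1) * (2 * Real.pi * l * Complex.I)‖ = (j + 1) * (2 * Real.pi * l) := by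
      have e1 : ((j : ℂ) + 1) * (2 * Real.pi * l * Complex.I) =
        (((j + 1) * (2 * Real.pi * l) : ℝ) : ℂ) * Complex.I := by push_cast; ring
      rw [e1, norm_mul, Complex.norm_I, mul_one, Complex.norm_real, Real.norm_of_nonneg (by positivity)]
    rw [e]
    have q1 := h₁ s l L hs₁ hs₂ hl hL hlL hg
    have q2 := h₂ s l L hs₁ hs₂ hl hL hlL hg
    rw [show j + 1 + K = j + (K + 1) by ring] at q1
    rw [show j + 2 + K = (j + (K + 1)) + 1 by ring] at q2
    calc _ ≤ C₁ * (L ^ (j + (K + 1)))⁻¹ + (j + 1) * (2 * Real.pi * (M * L)) *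
          (C₂ * (L ^ (j + (K + 1) + 1))⁻¹) := by gcongr
      _ = _ := by rw [pow_succ L (j + (K + 1))]; field_simp

end

/-- The weight `Φ` twisted by the additive character of frequency `-l`. -/
def twist (Φ : ℝ → ℝ) (l v : ℝ) : ℂ := Φ v * Complex.exp (-((2 * Real.pi * l * v : ℝ) * Complex.I))

section

variable {Φ : ℝ → ℝ} {a b : ℝ}

theorem norm_twist (l v : ℝ) : ‖twist Φ l v‖ = |Φ v| := by
  rw [twist, norm_mul, ← neg_mul, ← Complex.ofReal_neg, Complex.norm_exp_ofReal_mul_I, mul_one,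
    Complex.norm_real, Real.norm_eq_abs]

theorem contDiff_twist (hΦ : ContDiff ℝ (⊤ : ℕ∞) Φ) (l : ℝ) :
    ContDiff ℝ (⊤ : ℕ∞) (twist Φ l) := by
  have h : ContDiff ℝ (⊤ : ℕ∞) fun v : ℝ => 2 * Real.pi * l * v := contDiff_const.mul contDiff_id
  exact (Complex.ofRealCLM.contDiff.comp hΦ).mul
    (((Complex.ofRealCLM.contDiff.comp h).mul contDiff_const).neg).cexp

theorem apply_eq_zero_of_tsupport_subset_Ioo (hsupp : tsupport Φ ⊆ Ioo a b) {v : ℝ}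
    (hv : v ∉ Ioo a b) : Φ v = 0 :=
  image_eq_zero_of_notMem_tsupport fun h => hv (hsupp h)

theorem twist_eq_zero (hsupp : tsupport Φ ⊆ Ioo a b) (l : ℝ) {v : ℝ} (hv : v ∉ Ioo a b) :
    twist Φ l v = 0 := by
  simp [twist, apply_eq_zero_of_tsupport_subset_Ioo hsupp hv]

theorem contDiff_div_self (ha : 0 < a) (hΦ : ContDiff ℝ (⊤ : ℕ∞) Φ)
    (hsupp : tsupport Φ ⊆ Ioo a b) : ContDiff ℝ (⊤ : ℕ∞) fun v => ((Φ v / v : ℝ) : ℂ) := by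
  suffices h : ContDiff ℝ (⊤ : ℕ∞) fun v => Φ v / v from Complex.ofRealCLM.contDiff.comp h
  refine contDiff_iff_contDiffAt.2 fun v => ?_
  rcases lt_or_ge v a with hv | hv
  · refine (contDiffAt_const (c := (0 : ℝ))).congr_of_eventuallyEq ?_
    filter_upwards [Iio_mem_nhds hv] with w hw
    rw [apply_eq_zero_of_tsupport_subset_Ioo hsupp fun h => hw.not_gt h.1, zero_div]
  · exact hΦ.contDiffAt.div contDiffAt_id (ha.trans_le hv).ne'

theorem tsupport_div_self_subset (hsupp : tsupport Φ ⊆ Ioo a b) :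
    tsupport (fun v => ((Φ v / v : ℝ) : ℂ)) ⊆ Ioo a b := by
  refine (closure_mono fun v hv => ?_).trans hsupp
  simp only [Function.mem_support] at hv ⊢
  contrapose! hv
  simp [hv]

theorem mellin_twist_eq (ha : 0 < a) (hab : a < b) (hsupp : tsupport Φ ⊆ Ioo a b) (s : ℂ) (l : ℝ) :
    mellin (twist Φ l) s = oscIntegral a b (fun v => ((Φ v / v : ℝ) : ℂ)) 0 s l := by
  rw [mellin, oscIntegral, intervalIntegral.integral_of_le hab.le]
  rw [setIntegral_eq_of_subset_of_forall_sdiff_eq_zero measurableSet_Ioi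
    (s := Ioc a b) (fun v hv => ha.trans hv.1)]
  · refine setIntegral_congr_fun measurableSet_Ioc fun v hv => ?_
    have hv0 : 0 < v := ha.trans hv.1
    have hv0' : (v : ℂ) ≠ 0 := by exact_mod_cast hv0.ne'
    simp only [smul_eq_mul, twist, oscKernel, pow_zero, inv_one, mul_one, sub_eq_add_neg,
      Complex.exp_add]
    rw [← sub_eq_add_neg, Complex.cpow_sub _ _ hv0', Complex.cpow_one,
      Complex.cpow_def_of_ne_zero hv0', Complex.ofReal_log hv0.le, mul_comm s]
    push_cast
    field_simp
  · intro v hv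
    rw [twist_eq_zero hsupp l fun h => hv.2 ⟨h.1, h.2.le⟩, smul_zero]

theorem exists_norm_mellin_twist_le (ha : 0 < a) (hab : a < b) (hΦ : ContDiff ℝ (⊤ : ℕ∞) Φ)
    (hsupp : tsupport Φ ⊆ Ioo a b) (K : ℕ) :
    ∃ C : ℝ, 0 ≤ C ∧ ∀ (s : ℂ) (l : ℝ), 0 ≤ s.re → s.re ≤ 2 → 0 < l →
      (s.im ≤ Real.pi * a * l ∨ 4 * Real.pi * b * l ≤ s.im) →
      ‖mellin (twist Φ l) s‖ ≤ C * ((l + |s.im|) ^ K)⁻¹ := by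
  set c : ℝ := min (1 / 4) a with hc
  have hc0 : 0 < c := lt_min (by norm_num) ha
  have hc1 : c ≤ 1 / 4 := min_le_left _ _
  have hca : c ≤ a := min_le_right _ _
  obtain ⟨C, hC, h⟩ := exists_norm_oscIntegral_le ha hab (M := 1 / c) (by positivity) K _
    (contDiff_div_self ha hΦ hsupp) (tsupport_div_self_subset hsupp) 0
  refine ⟨C * (c ^ K)⁻¹, by positivity, fun s l hs₁ hs₂ hl ht => ?_⟩
  have hb : 0 < b := ha.trans hab
  have hpi := Real.pi_gt_three
  have := h s l (c * (l + |s.im|)) hs₁ hs₂ hl.le (by positivity) ?_ fun v hv => ?_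
  · rw [mellin_twist_eq ha hab hsupp]
    refine this.trans (le_of_eq ?_)
    rw [zero_add, mul_pow, mul_inv, mul_assoc]
  · rw [← mul_assoc, one_div_mul_cancel hc0.ne', one_mul]
    exact le_add_of_nonneg_right (abs_nonneg _)
  · refine le_trans ?_ (Complex.abs_im_le_norm _)
    have e : (oscPhase s l v).im = s.im - 2 * Real.pi * l * v := by simp [oscPhase]
    rw [e]
    have hal : 0 < a * l := by positivity
    have hbl : a * l ≤ b * l := by gcongr
    have hlv : l * a ≤ l * v := by have := hv.1; gcongr
    have hlv' : l * v ≤ l * b := by have := hv.2; gcongr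
    have hcl : c * l ≤ a * l := by gcongr
    have hct : c * |s.im| ≤ 1 / 4 * |s.im| := by gcongr
    rcases ht with ht | ht
    · refine le_trans ?_ (neg_le_abs _)
      have h1 : Real.pi * (l * a) ≤ Real.pi * (l * v) := by gcongr
      have h2 : 3 * (a * l) ≤ Real.pi * (a * l) := by gcongr
      rcases abs_cases s.im with ⟨h3, h4⟩ | ⟨h3, h4⟩ <;> rw [h3] at hct ⊢ <;> nlinarith
    · refine le_trans ?_ (le_abs_self _)
      have h1 : Real.pi * (l * v) ≤ Real.pi * (l * b) := by gcongr
      have h2 : 3 * (b * l) ≤ Real.pi * (b * l) := by gcongr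
      have h4 : 0 ≤ s.im := le_trans (by positivity) ht
      rw [abs_of_nonneg h4] at hct ⊢
      nlinarith

open FourierTransform SchwartzMap in
theorem exists_integral_norm_mellin_twist_le (ha : 0 < a) (hab : a < b)
    (hΦ : ContDiff ℝ (⊤ : ℕ∞) Φ) (hsupp : tsupport Φ ⊆ Ioo a b) (σ : ℝ) :
    ∃ C : ℝ, 0 ≤ C ∧ ∀ l : ℝ, 0 < l →
      ∫ t in (Real.pi * a * l)..(4 * Real.pi * b * l), ‖mellin (twist Φ l) (σ + t * Complex.I)‖ ≤
        C * l ^ (1 / 2 : ℝ) := by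
  set B : ℝ := ∫ u : ℝ, (Real.exp (-σ * u) * |Φ (Real.exp (-u))|) ^ 2 with hB
  have hB0 : 0 ≤ B := integral_nonneg fun u => sq_nonneg _
  have hpi := Real.pi_pos
  have hb : 0 < b := ha.trans hab
  refine ⟨Real.pi * B + (4 * Real.pi * b - Real.pi * a) / 2, ?_, fun l hl => ?_⟩
  · have : Real.pi * a ≤ 4 * Real.pi * b := by nlinarith
    have := sub_nonneg.2 this
    positivity
  have hle : Real.pi * a * l ≤ 4 * Real.pi * b * l := by
    have : Real.pi * a ≤ 4 * Real.pi * b := by nlinarith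
    gcongr
  set g : ℝ → ℂ := fun u => Real.exp (-σ * u) • twist Φ l (Real.exp (-u)) with hg
  have hgs : ContDiff ℝ (⊤ : ℕ∞) g :=
    (contDiff_const.mul contDiff_id).exp.smul ((contDiff_twist hΦ l).comp contDiff_neg.exp)
  have hgc : HasCompactSupport g := by
    refine HasCompactSupport.intro (isCompact_Icc (a := -Real.log b) (b := -Real.log a))
      fun u hu => ?_
    rw [hg]
    simp only
    rw [twist_eq_zero hsupp l, smul_zero]
    rintro ⟨h1, h2⟩
    refine hu ⟨?_, ?_⟩
    · have := (Real.lt_log_iff_exp_lt hb).2 h2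
      linarith
    · have := (Real.log_lt_iff_lt_exp ha).2 h1
      linarith
  set G : 𝓢(ℝ, ℂ) := hgc.toSchwartzMap hgs with hG
  have hGg : (G : ℝ → ℂ) = g := rfl
  have hF : ∀ t : ℝ, mellin (twist Φ l) (σ + t * Complex.I) = 𝓕 G (t / (2 * Real.pi)) := fun t => by
    rw [mellin_eq_fourier, SchwartzMap.fourier_coe, hGg]
    simp [hg]
  have hnorm : ∫ t : ℝ, ‖mellin (twist Φ l) (σ + t * Complex.I)‖ ^ 2 = 2 * Real.pi * B := by
    simp_rw [hF]
    rw [Measure.integral_comp_div (fun x => ‖𝓕 G x‖ ^ 2), SchwartzMap.integral_norm_sq_fourier, hB,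
      abs_of_pos (by positivity), smul_eq_mul]
    congr 1
    refine integral_congr_ae (ae_of_all _ fun u => ?_)
    simp only
    rw [hGg, hg]
    simp only
    rw [norm_smul, norm_twist, Real.norm_of_nonneg (Real.exp_pos _).le]
  have hInt : Integrable fun t : ℝ => ‖mellin (twist Φ l) (σ + t * Complex.I)‖ ^ 2 := by
    simp_rw [hF]
    refine Integrable.comp_div (g := fun x => ‖𝓕 G x‖ ^ 2) ?_ (by positivity)
    have := (𝓕 G).memLp 2 volume
    exact (memLp_two_iff_integrable_sq_norm this.1).1 this
  have hd := differentiable_mellin_of_support_subset ha (contDiff_twist hΦ l).continuous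
    (fun v hv => twist_eq_zero hsupp l fun h => hv ⟨h.1.le, h.2.le⟩)
  have hcont : Continuous fun t : ℝ => ‖mellin (twist Φ l) (σ + t * Complex.I)‖ :=
    (hd.continuous.comp (by fun_prop)).norm
  set k : ℝ := l ^ (1 / 2 : ℝ) with hk
  have hk0 : 0 < k := by positivity
  have hkk : l = k * k := by rw [hk, ← Real.rpow_add hl]; norm_num
  calc ∫ t in (Real.pi * a * l)..(4 * Real.pi * b * l), ‖mellin (twist Φ l) (σ + t * Complex.I)‖
      ≤ ∫ t in (Real.pi * a * l)..(4 * Real.pi * b * l),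
          (k / 2 * ‖mellin (twist Φ l) (σ + t * Complex.I)‖ ^ 2 + k⁻¹ / 2) := by
        refine intervalIntegral.integral_mono_on hle (hcont.intervalIntegrable _ _)
          (Continuous.intervalIntegrable (by fun_prop) _ _) fun t _ => ?_
        set z := ‖mellin (twist Φ l) (σ + t * Complex.I)‖
        have h1 : 0 ≤ k⁻¹ * (k * z - 1) ^ 2 := by positivity
        have h2 : k⁻¹ * (k * z - 1) ^ 2 = k * z ^ 2 - 2 * z + k⁻¹ := by field_simp; ring
        linarith
    _ = k / 2 * (∫ t in (Real.pi * a * l)..(4 * Real.pi * b * l),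
          ‖mellin (twist Φ l) (σ + t * Complex.I)‖ ^ 2) +
          (4 * Real.pi * b * l - Real.pi * a * l) * (k⁻¹ / 2) := by
        rw [intervalIntegral.integral_add (Continuous.intervalIntegrable (by fun_prop) _ _)
          intervalIntegrable_const, intervalIntegral.integral_const_mul,
          intervalIntegral.integral_const, smul_eq_mul]
    _ ≤ k / 2 * (2 * Real.pi * B) + (4 * Real.pi * b * l - Real.pi * a * l) * (k⁻¹ / 2) := by
        gcongr
        rw [← hnorm, intervalIntegral.integral_of_le hle]
        exact setIntegral_le_integral hInt (ae_of_all _ fun t => sq_nonneg _)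
    _ = _ := by rw [hkk]; field_simp

end

theorem differentiableAt_prod_primesBelow (N : ℕ) {s : ℂ} (hs : 0 < s.re) :
    DifferentiableAt ℂ (fun s => ∏ p ∈ N.primesBelow, (1 - (p : ℂ) ^ (-s))⁻¹) s := by
  refine DifferentiableAt.fun_finsetProd fun p hp => ?_
  have hp' := Nat.prime_of_mem_primesBelow hp
  have hp0 : (p : ℂ) ≠ 0 := by exact_mod_cast hp'.ne_zero
  refine DifferentiableAt.inv
    ((differentiableAt_id.neg.const_cpow (Or.inl hp0)).const_sub 1) fun h => ?_
  have h1 : (p : ℂ) ^ (-s) = 1 := (sub_eq_zero.1 h).symm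
  have h2 := norm_natCast_cpow_neg hp'.pos s
  rw [h1, norm_one] at h2
  have : (p : ℝ) ^ (-s.re) < 1 :=
    Real.rpow_lt_one_of_one_lt_of_neg (by exact_mod_cast hp'.one_lt) (neg_lt_zero.2 hs)
  linarith

theorem LSeries_indicator_smoothNumbers (N : ℕ) {s : ℂ} (hs : 1 < s.re) :
    LSeries (N.smoothNumbers.indicator fun _ => 1) s =
      ∏ p ∈ N.primesBelow, (1 - (p : ℂ) ^ (-s))⁻¹ := by
  have h := EulerProduct.prod_primesBelow_geometric_eq_tsum_smoothNumbers
    (f := (riemannZetaSummandHom (Complex.ne_zero_of_one_lt_re hs) : ℕ →* ℂ))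
    (summable_riemannZetaSummand hs).of_norm N
  simp only [riemannZetaSummandHom, MonoidHom.coe_coe, MonoidWithZeroHom.coe_mk,
    ZeroHom.coe_mk] at h
  rw [h, tsum_subtype (N.smoothNumbers) fun n : ℕ => (n : ℂ) ^ (-s), LSeries]
  refine tsum_congr fun n => ?_
  rcases eq_or_ne n 0 with rfl | hn
  · rw [LSeries.term_zero, indicator_of_notMem fun h => Nat.ne_zero_of_mem_smoothNumbers h rfl]
  · rw [LSeries.term_of_ne_zero hn]
    by_cases hm : n ∈ N.smoothNumbers <;> simp [hm, Complex.cpow_neg]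

theorem norm_mellin_comp_mul_left {f : ℝ → ℂ} {X : ℝ} (hX : 0 < X) (s : ℂ) :
    ‖mellin (fun v => f (X⁻¹ * v)) s‖ = X ^ s.re * ‖mellin f s‖ := by
  rw [mellin_comp_mul_left f s (inv_pos.2 hX), norm_smul,
    Complex.norm_cpow_eq_rpow_re_of_pos (inv_pos.2 hX), Complex.neg_re,
    Real.inv_rpow hX.le, Real.rpow_neg hX.le, inv_inv]

theorem exists_norm_tsum_smoothNumbers_twist_le
    (hRH : ∀ s : ℂ, 1 / 2 < s.re → 1 ≤ s.im → riemannZeta s ≠ 0)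
    {Φ : ℝ → ℝ} {a b : ℝ} (ha : 0 < a) (hab : a < b) (hΦ : ContDiff ℝ (⊤ : ℕ∞) Φ)
    (hsupp : tsupport Φ ⊆ Ioo a b) {η ε : ℝ} (hη : 0 < η) (hη' : η ≤ 1 / 4) (hε : 0 < ε) (k : ℕ) :
    ∃ C : ℝ, 0 ≤ C ∧ ∀ (l X : ℝ) (N : ℕ), 1 ≤ l → 12 ≤ Real.pi * a * l → 0 < N →
      (N : ℝ) ^ 6 ≤ Real.pi * a * l → 1 ≤ X → X ≤ l ^ k →
      ‖∑' n : ℕ, N.smoothNumbers.indicator (fun _ => 1) n * twist Φ l (X⁻¹ * n)‖ ≤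
        C * (l ^ (1 / 2 + ε) * X ^ (1 / 2 + 2 * η)) := by
  obtain ⟨C₁, hC₁, h₁⟩ := exists_norm_prod_primesBelow_le hRH hη hη' hε
  obtain ⟨C₂, hC₂, h₂⟩ := exists_norm_mellin_twist_le ha hab hΦ hsupp (2 * k + 2)
  obtain ⟨C₃, hC₃, h₃⟩ := exists_integral_norm_mellin_twist_le ha hab hΦ hsupp (1 / 2 + 2 * η)
  have hb : 0 < b := ha.trans hab
  have hpi := Real.pi_pos
  set B : ℝ := C₁ * (4 * Real.pi * b) ^ ε with hB
  have hB0 : 0 ≤ B := by positivity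
  set S : ℝ := ∑' n, ‖LSeries.term 1 2 n‖ with hS
  have hS0 : 0 ≤ S := tsum_nonneg fun n => norm_nonneg _
  have hdec := decayIntegral_nonneg
  refine ⟨S * C₂ * decayIntegral + 2 * (B * C₂) * 2 + B * C₃, by positivity,
    fun l X N hl hl12 hN hNl hX hXl => ?_⟩
  have hl0 : 0 < l := by linarith
  have hX0 : 0 < X := by linarith
  set D : ℂ → ℂ := fun s => ∏ p ∈ N.primesBelow, (1 - (p : ℂ) ^ (-s))⁻¹ with hD
  set c : ℕ → ℂ := N.smoothNumbers.indicator fun _ => 1 with hc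
  have hc1 : ∀ n, ‖c n‖ ≤ 1 := fun n => by
    by_cases hm : n ∈ N.smoothNumbers <;> simp [hc, hm]
  have hT : Real.pi * a * l ≤ 4 * Real.pi * b * l := by
    have : Real.pi * a ≤ 4 * Real.pi * b := by nlinarith
    gcongr
  have hDle : ∀ s : ℂ, 1 / 2 + 2 * η ≤ s.re → s.re ≤ 2 → Real.pi * a * l ≤ s.im →
      s.im ≤ 4 * Real.pi * b * l → ‖D s‖ ≤ B * l ^ ε := fun s hs₁ hs₂ ht₁ ht₂ => by
    refine (h₁ s N (hl12.trans ht₁) hs₁ hs₂ hN (hNl.trans ht₁)).trans ?_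
    have h0 : 0 ≤ s.im := by linarith
    calc C₁ * s.im ^ ε ≤ C₁ * (4 * Real.pi * b * l) ^ ε := by gcongr
      _ = _ := by rw [Real.mul_rpow (by positivity) hl0.le, hB, ← mul_assoc]
  have hX2 : ∀ σ : ℝ, 0 ≤ σ → σ ≤ 2 → X ^ σ ≤ l ^ (2 * k) := fun σ _ hσ => by
    calc X ^ σ ≤ X ^ (2 : ℝ) := Real.rpow_le_rpow_of_exponent_le hX hσ
      _ = X ^ 2 := by norm_cast
      _ ≤ (l ^ k) ^ 2 := by gcongr
      _ = _ := by rw [← pow_mul, mul_comm]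
  have hFle : ∀ s : ℂ, 0 ≤ s.re → s.re ≤ 2 →
      (s.im ≤ Real.pi * a * l ∨ 4 * Real.pi * b * l ≤ s.im) →
      ‖mellin (fun v => twist Φ l (X⁻¹ * v)) s‖ ≤ C₂ * ((l + |s.im|) ^ 2)⁻¹ := fun s hs₁ hs₂ ht => by
    rw [norm_mellin_comp_mul_left hX0]
    have h4 : l ^ (2 * k) ≤ (l + |s.im|) ^ (2 * k) := by
      gcongr; exact le_add_of_nonneg_right (abs_nonneg _)
    have h5 : 0 < l + |s.im| := by positivity
    calc X ^ s.re * ‖mellin (twist Φ l) s‖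
        ≤ (l + |s.im|) ^ (2 * k) * (C₂ * ((l + |s.im|) ^ (2 * k + 2))⁻¹) :=
          mul_le_mul ((hX2 _ hs₁ hs₂).trans h4) (h₂ s l hs₁ hs₂ hl0 ht) (norm_nonneg _)
            (by positivity)
      _ = _ := by rw [pow_add]; field_simp
  have hw : Continuous fun v => twist Φ l (X⁻¹ * v) :=
    (contDiff_twist hΦ l).continuous.comp (by fun_prop)
  have hws : ∀ v, v ∉ Icc (X * a) (X * b) → twist Φ l (X⁻¹ * v) = 0 := fun v hv => by
    refine twist_eq_zero hsupp l fun h => hv ⟨?_, ?_⟩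
    · have := (lt_inv_mul_iff₀ hX0).1 h.1; exact this.le
    · have := (inv_mul_lt_iff₀ hX0).1 h.2; exact this.le
  have hl1 : 1 ≤ l ^ ε := Real.one_le_rpow hl hε.le
  have hE' : ∀ s : ℂ, 1 / 2 + 2 * η ≤ s.re → s.re ≤ 2 → (s.im = Real.pi * a * l ∨
      s.im = 4 * Real.pi * b * l) → ‖D s * mellin (fun v => twist Φ l (X⁻¹ * v)) s‖ ≤
      B * l ^ ε * C₂ := fun s hs₁ hs₂ ht => by
    rw [norm_mul]
    refine mul_le_mul (hDle s hs₁ hs₂ ?_ ?_) ((hFle s (by linarith) hs₂ ?_).trans ?_)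
      (norm_nonneg _) (by positivity)
    · rcases ht with ht | ht <;> rw [ht]; exact hT
    · rcases ht with ht | ht <;> rw [ht]; exact hT
    · rcases ht with ht | ht
      · exact Or.inl ht.le
      · exact Or.inr ht.ge
    · refine mul_le_of_le_one_right hC₂ (inv_le_one_of_one_le₀ (one_le_pow₀ ?_))
      have := abs_nonneg s.im
      linarith
  have main := norm_tsum_mul_le_of_mellin (a := c) (D := D) (E := C₂) (E' := B * l ^ ε * C₂)
    (t₁ := Real.pi * a * l) (t₂ := 4 * Real.pi * b * l) (σ₁ := 1 / 2 + 2 * η) (σ₂ := 2)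
    (mul_pos hX0 ha) hw hws (by linarith) hT
    (LSeriesSummable_of_bounded_of_one_lt_real (fun n _ => hc1 n) (by norm_num))
    (fun τ => (LSeries_indicator_smoothNumbers N (by simp)).symm)
    (fun s hs _ _ _ => differentiableAt_prod_primesBelow N (by linarith))
    (fun τ hτ => ?_) (fun σ hσ => hE' _ (by simpa using hσ.1) (by simpa using hσ.2) (by simp))
    (fun σ hσ => hE' _ (by simpa using hσ.1) (by simpa using hσ.2) (by simp))
  · refine main.trans ?_
    have hterm : ∑' n, ‖LSeries.term c (2 : ℝ) n‖ ≤ S := by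
      have hs1 : LSeriesSummable 1 2 :=
        LSeriesSummable_of_bounded_of_one_lt_re (m := 1) (fun n _ => by simp) (by simp)
      have hsc : LSeriesSummable c 2 :=
        LSeriesSummable_of_bounded_of_one_lt_re (m := 1) (fun n _ => hc1 n) (by simp)
      push_cast
      refine Summable.tsum_le_tsum (fun n => LSeries.norm_term_le _ ?_) hsc.norm hs1.norm
      simpa using hc1 n
    have hone : 1 ≤ l ^ (1 / 2 + ε) * X ^ (1 / 2 + 2 * η) :=
      one_le_mul_of_one_le_of_one_le (Real.one_le_rpow hl (by positivity))
        (Real.one_le_rpow hX (by positivity))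
    have hle : l ^ ε ≤ l ^ (1 / 2 + ε) * X ^ (1 / 2 + 2 * η) := by
      refine le_trans ?_ (le_mul_of_one_le_right (by positivity)
        (Real.one_le_rpow hX (by positivity)))
      exact Real.rpow_le_rpow_of_exponent_le hl (by linarith)
    have hcont : ∀ f : ℝ → ℂ, Continuous f → (∀ v, v ∉ Icc (X * a) (X * b) → f v = 0) →
        Continuous fun τ : ℝ => mellin f ((1 / 2 + 2 * η : ℝ) + τ * Complex.I) := fun f hf hf' =>
      (differentiable_mellin_of_support_subset (mul_pos hX0 ha) hf hf').continuous.comp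
        (by fun_prop)
    have hInt : ∫ τ in (Real.pi * a * l)..(4 * Real.pi * b * l),
        ‖D ((1 / 2 + 2 * η : ℝ) + τ * Complex.I) *
          mellin (fun v => twist Φ l (X⁻¹ * v)) ((1 / 2 + 2 * η : ℝ) + τ * Complex.I)‖ ≤
        B * C₃ * (l ^ (1 / 2 + ε) * X ^ (1 / 2 + 2 * η)) := by
      calc _ ≤ ∫ τ in (Real.pi * a * l)..(4 * Real.pi * b * l),
            B * l ^ ε * X ^ (1 / 2 + 2 * η) *
              ‖mellin (twist Φ l) ((1 / 2 + 2 * η : ℝ) + τ * Complex.I)‖ := by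
            refine intervalIntegral.integral_mono_on hT ?_ ?_ fun τ hτ => ?_
            · refine ContinuousOn.intervalIntegrable fun τ _ => ?_
              refine ContinuousAt.continuousWithinAt (ContinuousAt.norm (ContinuousAt.mul ?_
                (hcont _ hw hws).continuousAt))
              refine ContinuousAt.comp (g := D) (DifferentiableAt.continuousAt
                (differentiableAt_prod_primesBelow N ?_)) (by fun_prop)
              simp; positivity
            · refine (Continuous.intervalIntegrable ?_ _ _)
              refine continuous_const.mul (Continuous.norm ?_)
              exact (differentiable_mellin_of_support_subset ha (contDiff_twist hΦ l).continuous
                (fun v hv => twist_eq_zero hsupp l fun h => hv ⟨h.1.le, h.2.le⟩)).continuous.comp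
                  (by fun_prop)
            · rw [norm_mul, norm_mellin_comp_mul_left hX0, mul_assoc (B * l ^ ε)]
              refine mul_le_mul (hDle _ ?_ ?_ ?_ ?_) ?_ (by positivity) (by positivity)
              · simp
              · simp; linarith
              · simpa using hτ.1
              · simpa using hτ.2
              · simp
        _ ≤ B * l ^ ε * X ^ (1 / 2 + 2 * η) * (C₃ * l ^ (1 / 2 : ℝ)) := by
            rw [intervalIntegral.integral_const_mul]
            gcongr
            exact h₃ l hl0
        _ = _ := by rw [Real.rpow_add hl0]; ring
    have h6 : 2 * (B * l ^ ε * C₂) * (2 - (1 / 2 + 2 * η)) ≤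
        2 * (B * C₂) * 2 * (l ^ (1 / 2 + ε) * X ^ (1 / 2 + 2 * η)) := by
      calc 2 * (B * l ^ ε * C₂) * (2 - (1 / 2 + 2 * η)) ≤ 2 * (B * l ^ ε * C₂) * 2 := by
            gcongr; linarith
        _ = 2 * (B * C₂) * 2 * l ^ ε := by ring
        _ ≤ _ := by gcongr
    have h7 : (∑' n, ‖LSeries.term c (2 : ℝ) n‖) * C₂ * decayIntegral ≤
        S * C₂ * decayIntegral * (l ^ (1 / 2 + ε) * X ^ (1 / 2 + 2 * η)) := by
      refine le_trans ?_ (le_mul_of_one_le_right (by positivity) hone)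
      gcongr
    rw [add_mul, add_mul]
    exact add_le_add (add_le_add h7 h6) hInt
  · have hτ' : τ ≤ Real.pi * a * l ∨ 4 * Real.pi * b * l ≤ τ := by
      rw [mem_Icc, not_and_or, not_le, not_le] at hτ
      exact hτ.imp le_of_lt le_of_lt
    refine (hFle _ (by simp) (by simp) (by simpa using hτ')).trans ?_
    have e : ((2 : ℝ) + τ * Complex.I : ℂ).im = τ := by simp
    rw [e, Real.norm_eq_abs, Real.rpow_neg (by positivity)]
    have h8 : (1 + |τ|) ^ (3 / 2 : ℝ) ≤ (l + |τ|) ^ 2 := by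
      have := abs_nonneg τ
      calc (1 + |τ|) ^ (3 / 2 : ℝ) ≤ (1 + |τ|) ^ (2 : ℝ) :=
            Real.rpow_le_rpow_of_exponent_le (by linarith) (by norm_num)
        _ = (1 + |τ|) ^ 2 := by norm_cast
        _ ≤ _ := by gcongr
    gcongr

theorem exists_card_divisors_le {k : ℕ} (hk : 0 < k) :
    ∃ C : ℝ, 0 ≤ C ∧ ∀ n : ℕ, 0 < n → (n.divisors.card : ℝ) ≤ C * (n : ℝ) ^ (1 / k : ℝ) := by
  have hk1 : (1 : ℝ) ≤ k := by exact_mod_cast hk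
  have hk0 : (0 : ℝ) < k := by linarith
  refine ⟨(2 * k) ^ (2 ^ k : ℕ), by positivity, fun n hn => ?_⟩
  set c : ℕ → ℝ := fun p => if p < 2 ^ k then 2 * k else 1 with hc
  have hc0 : ∀ p, 0 ≤ c p := fun p => by simp only [hc]; split_ifs <;> positivity
  have hfac : ∀ p ∈ n.primeFactors, ((n.factorization p : ℝ) + 1) ≤
      c p * ((p : ℝ) ^ n.factorization p) ^ (1 / k : ℝ) := by
    intro p hp
    have hp2 : 2 ≤ p := (Nat.prime_of_mem_primeFactors hp).two_le
    set e := n.factorization p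
    by_cases h : p < 2 ^ k
    · simp only [hc, h, if_true]
      have h1 : ((2 : ℝ) ^ e) ^ (1 / k : ℝ) ≤ ((p : ℝ) ^ e) ^ (1 / k : ℝ) := by
        gcongr; exact_mod_cast hp2
      have h2 : ((2 : ℝ) ^ e) ^ (1 / k : ℝ) = Real.exp (Real.log 2 * (e / k)) := by
        rw [← Real.rpow_natCast, ← Real.rpow_mul zero_le_two, Real.rpow_def_of_pos two_pos]
        ring_nf
      have h3 := Real.add_one_le_exp (Real.log 2 * (e / k))
      have h4 : 1 / 2 * ((e : ℝ) / k) ≤ Real.log 2 * (e / k) := by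
        have := Real.log_two_gt_d9
        gcongr; linarith
      have h5 : 2 * k * (1 / 2 * ((e : ℝ) / k)) = e := by field_simp
      calc (e : ℝ) + 1 ≤ 2 * k * (1 / 2 * ((e : ℝ) / k)) + 2 * k := by rw [h5]; linarith
        _ = 2 * k * (1 / 2 * ((e : ℝ) / k) + 1) := by ring
        _ ≤ 2 * k * ((p : ℝ) ^ e) ^ (1 / k : ℝ) := by gcongr; linarith
    · simp only [hc, h, if_false, one_mul]
      have h1 : ((2 : ℝ) ^ k) ≤ p := by exact_mod_cast not_lt.1 h
      calc (e : ℝ) + 1 ≤ (2 : ℝ) ^ e := by exact_mod_cast Nat.lt_two_pow_self (n := e)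
        _ = (((2 : ℝ) ^ k) ^ e) ^ (1 / k : ℝ) := by
            rw [← pow_mul, mul_comm, pow_mul, one_div, Real.pow_rpow_inv_natCast (by positivity) hk.ne']
        _ ≤ _ := by gcongr
  have hcp : ∏ p ∈ n.primeFactors, c p ≤ (2 * k : ℝ) ^ (2 ^ k : ℕ) := by
    calc ∏ p ∈ n.primeFactors, c p = ∏ p ∈ n.primeFactors with p < 2 ^ k, (2 * k : ℝ) := by
          rw [Finset.prod_filter]
      _ = (2 * k : ℝ) ^ (n.primeFactors.filter (· < 2 ^ k)).card := by rw [Finset.prod_const]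
      _ ≤ _ := by
          refine pow_le_pow_right₀ (by linarith) ?_
          calc _ ≤ (Finset.range (2 ^ k)).card := Finset.card_le_card fun p hp => by
                simpa using (Finset.mem_filter.1 hp).2
            _ = _ := Finset.card_range _
  rw [Nat.card_divisors hn.ne']
  push_cast
  calc ∏ p ∈ n.primeFactors, ((n.factorization p : ℝ) + 1)
      ≤ ∏ p ∈ n.primeFactors, c p * ((p : ℝ) ^ n.factorization p) ^ (1 / k : ℝ) :=
        Finset.prod_le_prod (fun p _ => by positivity) hfac
    _ = (∏ p ∈ n.primeFactors, c p) *
          (∏ p ∈ n.primeFactors, (p : ℝ) ^ n.factorization p) ^ (1 / k : ℝ) := by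
        rw [Finset.prod_mul_distrib, Real.finsetProd_rpow _ _ fun p _ => by positivity]
    _ = (∏ p ∈ n.primeFactors, c p) * (n : ℝ) ^ (1 / k : ℝ) := by
        congr 2
        conv_rhs => rw [← Nat.prod_factorization_pow_eq_self hn.ne']
        rw [Finsupp.prod, Nat.support_factorization]
        push_cast
        rfl
    _ ≤ _ := by gcongr

theorem le_card_divisors_mul_totient (r : ℕ) : r ≤ r.divisors.card * r.totient := by
  conv_lhs => rw [← Nat.sum_totient r]
  refine (Finset.sum_le_card_nsmul _ _ r.totient fun d hd => ?_).trans_eq (by rw [smul_eq_mul])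
  obtain ⟨hd, hr⟩ := Nat.mem_divisors.1 hd
  exact Nat.le_of_dvd (Nat.totient_pos.2 (Nat.pos_of_ne_zero hr)) (Nat.totient_dvd_of_dvd hd)

/-- The arithmetic weight at gcd `d`. -/
def gcdWeight (q d : ℕ) : ℝ :=
  (ArithmeticFunction.moebius (q / d) : ℝ) / (Nat.totient (q / d) : ℝ)

/-- The Möbius transform of the arithmetic weight. -/
def gcdCoeff (q e : ℕ) : ℝ :=
  ∑ x ∈ e.divisorsAntidiagonal, ArithmeticFunction.moebius x.1 • gcdWeight q x.2

theorem gcdWeight_gcd_eq {q : ℕ} (hq : 0 < q) (n : ℕ) :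
    gcdWeight q (q.gcd n) = ∑ e ∈ q.divisors, if e ∣ n then gcdCoeff q e else 0 := by
  have h := (ArithmeticFunction.sum_eq_iff_sum_smul_moebius_eq (f := gcdCoeff q)
    (g := gcdWeight q)).2 (fun _ _ => rfl) (q.gcd n) (Nat.gcd_pos_of_pos_left _ hq)
  rw [← h, ← Finset.sum_filter]
  refine Finset.sum_congr ?_ fun _ _ => rfl
  ext e
  simp [Nat.dvd_gcd_iff, hq.ne']

theorem abs_gcdWeight_le {q d : ℕ} (hq : 0 < q) (hd : d ∣ q) :
    |gcdWeight q d| ≤ q.divisors.card * (d / q : ℝ) := by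
  obtain ⟨r, rfl⟩ := hd
  have hd0 : 0 < d := Nat.pos_of_mul_pos_right hq
  have hr0 : 0 < r := Nat.pos_of_mul_pos_left hq
  have hd0' : (0 : ℝ) < d := by exact_mod_cast hd0
  have hr0' : (0 : ℝ) < r := by exact_mod_cast hr0
  rw [gcdWeight, Nat.mul_div_cancel_left _ hd0, abs_div, Nat.abs_cast]
  have h1 : |(ArithmeticFunction.moebius r : ℝ)| ≤ 1 := by
    exact_mod_cast ArithmeticFunction.abs_moebius_le_one (n := r)
  have h2 : (0 : ℝ) < r.totient := by exact_mod_cast Nat.totient_pos.2 hr0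
  have h3 : (r : ℝ) ≤ (d * r).divisors.card * r.totient := by
    have h4 : r.divisors.card ≤ (d * r).divisors.card :=
      Finset.card_le_card (Nat.divisors_subset_of_dvd hq.ne' (Dvd.intro_left d rfl))
    exact_mod_cast (le_card_divisors_mul_totient r).trans (Nat.mul_le_mul_right _ h4)
  calc _ ≤ 1 / (r.totient : ℝ) := by gcongr
    _ ≤ (d * r).divisors.card * (1 / r : ℝ) := by
        rw [div_le_iff₀ h2]
        calc (1 : ℝ) = r * (1 / r) := by field_simp
          _ ≤ ((d * r).divisors.card * r.totient) * (1 / r) := by gcongr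
          _ = _ := by ring
    _ = _ := by push_cast; field_simp

theorem abs_gcdCoeff_le {q e : ℕ} (hq : 0 < q) (he : e ∣ q) :
    |gcdCoeff q e| ≤ (q.divisors.card : ℝ) ^ 2 * (e / q) := by
  have he0 : e ≠ 0 := fun h => hq.ne' (Nat.eq_zero_of_zero_dvd (h ▸ he))
  have hcard : (e.divisorsAntidiagonal.card : ℝ) ≤ q.divisors.card := by
    rw [← Nat.map_div_right_divisors, Finset.card_map]
    exact_mod_cast Finset.card_le_card (Nat.divisors_subset_of_dvd hq.ne' he)
  calc |gcdCoeff q e| ≤ ∑ x ∈ e.divisorsAntidiagonal,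
        |ArithmeticFunction.moebius x.1 • gcdWeight q x.2| := Finset.abs_sum_le_sum_abs _ _
    _ ≤ ∑ x ∈ e.divisorsAntidiagonal, (q.divisors.card : ℝ) * (e / q) := by
        refine Finset.sum_le_sum fun x hx => ?_
        have hx2 : x.2 ∣ e := Dvd.intro_left _ (Nat.mem_divisorsAntidiagonal.1 hx).1
        have h1 : |(ArithmeticFunction.moebius x.1 : ℝ)| ≤ 1 := by
          exact_mod_cast ArithmeticFunction.abs_moebius_le_one (n := x.1)
        have h3 : (x.2 : ℝ) ≤ e := by exact_mod_cast Nat.le_of_dvd (Nat.pos_of_ne_zero he0) hx2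
        rw [zsmul_eq_mul, abs_mul]
        calc _ ≤ 1 * ((q.divisors.card : ℝ) * (x.2 / q)) :=
              mul_le_mul h1 (abs_gcdWeight_le hq (hx2.trans he)) (abs_nonneg _) zero_le_one
          _ ≤ _ := by rw [one_mul]; gcongr
    _ = e.divisorsAntidiagonal.card * ((q.divisors.card : ℝ) * (e / q)) := by
        rw [Finset.sum_const, nsmul_eq_mul]
    _ ≤ q.divisors.card * ((q.divisors.card : ℝ) * (e / q)) := by gcongr
    _ = _ := by ring

theorem tsum_smoothNumbers_dvd_eq {N e : ℕ} (he : e ∈ N.smoothNumbers) (w : ℕ → ℂ) :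
    ∑' n : ℕ, (if e ∣ n then N.smoothNumbers.indicator (fun _ => 1) n * w n else 0) =
      ∑' m : ℕ, N.smoothNumbers.indicator (fun _ => 1) m * w (e * m) := by
  have he0 : 0 < e := Nat.pos_of_ne_zero (Nat.ne_zero_of_mem_smoothNumbers he)
  rw [← Function.Injective.tsum_eq (g := fun m => e * m)
    (fun m m' h => Nat.eq_of_mul_eq_mul_left he0 h)]
  · refine tsum_congr fun m => ?_
    rw [if_pos (dvd_mul_right e m)]
    by_cases hm : m ∈ N.smoothNumbers
    · simp [hm, Nat.mul_mem_smoothNumbers he hm]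
    · have : e * m ∉ N.smoothNumbers := fun h => hm (Nat.mem_smoothNumbers_of_dvd h ⟨e, mul_comm _ _⟩)
      simp [hm, this]
  · intro n hn
    by_contra h
    refine hn (if_neg fun ⟨m, hm⟩ => h ⟨m, hm.symm⟩)

theorem tsum_smoothNumbers_gcdWeight_eq {N q : ℕ} (hq : q ∈ N.smoothNumbers) {w : ℕ → ℂ}
    (hw : (Function.support w).Finite) :
    ∑' n : ℕ, (gcdWeight q (q.gcd n) : ℂ) * (N.smoothNumbers.indicator (fun _ => 1) n * w n) =
      ∑ e ∈ q.divisors, (gcdCoeff q e : ℂ) *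
        ∑' m : ℕ, N.smoothNumbers.indicator (fun _ => 1) m * w (e * m) := by
  have hq0 : 0 < q := Nat.pos_of_ne_zero (Nat.ne_zero_of_mem_smoothNumbers hq)
  have h : ∀ n : ℕ, (gcdWeight q (q.gcd n) : ℂ) * (N.smoothNumbers.indicator (fun _ => 1) n * w n) =
      ∑ e ∈ q.divisors, (gcdCoeff q e : ℂ) *
        (if e ∣ n then N.smoothNumbers.indicator (fun _ => 1) n * w n else 0) := fun n => by
    rw [gcdWeight_gcd_eq hq0, Complex.ofReal_sum, Finset.sum_mul]
    refine Finset.sum_congr rfl fun e _ => ?_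
    split_ifs <;> simp
  simp_rw [h]
  rw [Summable.tsum_finsetSum fun e _ => ?_]
  · refine Finset.sum_congr rfl fun e he => ?_
    rw [tsum_mul_left, tsum_smoothNumbers_dvd_eq
      (Nat.mem_smoothNumbers_of_dvd hq (Nat.dvd_of_mem_divisors he))]
  · refine summable_of_hasFiniteSupport (hw.subset fun n hn => ?_)
    simp only [Function.mem_support] at hn ⊢
    contrapose! hn
    simp [hn]

theorem GRH.riemannZeta_ne_zero (h : GRH) {s : ℂ} (hs : 1 / 2 < s.re) :
    riemannZeta s ≠ 0 := by
  rcases lt_or_ge s.re 1 with h1 | h1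
  · intro h0
    have := h.1 s (by linarith) h1 h0
    linarith
  · exact riemannZeta_ne_zero_of_one_le_re h1

theorem exists_Ioo_of_isCompact {K : Set ℝ} (hK : IsCompact K) (h : K ⊆ Ioi 0) :
    ∃ a b : ℝ, 0 < a ∧ a < b ∧ K ⊆ Ioo a b := by
  rcases K.eq_empty_or_nonempty with rfl | hne
  · exact ⟨1, 2, one_pos, one_lt_two, empty_subset _⟩
  · obtain ⟨m, hm, hmin⟩ := hK.exists_isLeast hne
    obtain ⟨M, hM, hmax⟩ := hK.exists_isGreatest hne
    have h0 : 0 < m := h hm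
    have h1 : m ≤ M := hmin hM
    exact ⟨m / 2, M + 1, by linarith, by linarith, fun v hv =>
      ⟨by linarith [hmin hv], by linarith [hmax hv]⟩⟩

theorem mem_smoothNumbers_floor_iff {y : ℝ} (hy : 0 ≤ y) (n : ℕ) :
    n ∈ (⌊y⌋₊ + 1).smoothNumbers ↔ 0 < n ∧ ∀ p : ℕ, p.Prime → p ∣ n → (p : ℝ) ≤ y := by
  rw [Nat.mem_smoothNumbers', Nat.pos_iff_ne_zero]
  refine ⟨fun h => ⟨fun h0 => ?_, fun p hp hd => (Nat.le_floor_iff hy).1 (Nat.lt_succ_iff.1 (h p hp hd))⟩,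
    fun h p hp hd => Nat.lt_succ_iff.2 ((Nat.le_floor_iff hy).2 (h.2 p hp hd))⟩
  obtain ⟨p, hp₁, hp⟩ := Nat.exists_infinite_primes (⌊y⌋₊ + 1)
  exact (h p hp (h0 ▸ dvd_zero p)).not_ge hp₁

theorem Mterm_neg_eq {x y : ℝ} (hx : 0 < x) (hy : 0 ≤ y) (Φ : ℝ → ℝ) (q : ℕ) (l : ℝ) :
    Mterm x y Φ q (-(l / x)) = ∑' n : ℕ, (gcdWeight q (q.gcd n) : ℂ) *
      ((⌊y⌋₊ + 1).smoothNumbers.indicator (fun _ => 1) n * twist Φ l (x⁻¹ * n)) := by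
  have hset : {n : ℕ | 0 < n ∧ ∀ p : ℕ, p.Prime → p ∣ n → (p : ℝ) ≤ y} =
      (⌊y⌋₊ + 1).smoothNumbers := by
    ext n; exact (mem_smoothNumbers_floor_iff hy n).symm
  have hx0 : (x : ℂ) ≠ 0 := by exact_mod_cast hx.ne'
  rw [← hset, Mterm]
  refine (tsum_subtype {n : ℕ | 0 < n ∧ ∀ p : ℕ, p.Prime → p ∣ n → (p : ℝ) ≤ y} fun n : ℕ =>
    (((ArithmeticFunction.moebius (q / Nat.gcd q (n : ℕ)) : ℝ) /
        (Nat.totient (q / Nat.gcd q (n : ℕ)) : ℝ) : ℝ) : ℂ) *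
      Complex.exp (2 * (Real.pi : ℂ) * Complex.I * ((n : ℕ) : ℂ) * ((-(l / x) : ℝ) : ℂ)) *
      ((Φ (((n : ℕ) : ℝ) / x) : ℝ) : ℂ)).trans (tsum_congr fun n => ?_)
  by_cases hn : n ∈ {n : ℕ | 0 < n ∧ ∀ p : ℕ, p.Prime → p ∣ n → (p : ℝ) ≤ y}
  · rw [indicator_of_mem hn, indicator_of_mem hn, twist, one_mul, mul_assoc, gcdWeight,
      mul_comm (Complex.exp _), inv_mul_eq_div]
    congr 4
    push_cast
    field_simp
  · rw [indicator_of_notMem hn, indicator_of_notMem hn, zero_mul, mul_zero]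

theorem norm_Mterm_neg (x y : ℝ) (Φ : ℝ → ℝ) (q : ℕ) (γ : ℝ) :
    ‖Mterm x y Φ q (-γ)‖ = ‖Mterm x y Φ q γ‖ := by
  rw [← Complex.norm_conj (Mterm x y Φ q γ), Mterm, Mterm, Complex.conj_tsum]
  congr 1
  refine tsum_congr fun n => ?_
  rw [map_mul, map_mul, Complex.conj_ofReal, Complex.conj_ofReal, ← Complex.exp_conj]
  congr 3
  simp [Complex.conj_ofNat]

theorem norm_sum_gcdCoeff_mul_le {q : ℕ} (hq : 0 < q) {f : ℕ → ℂ} {B : ℝ}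
    (hf : ∀ e ∈ q.divisors, ‖f e‖ ≤ B * (e : ℝ) ^ (-(1 / 2) : ℝ)) :
    ‖∑ e ∈ q.divisors, (gcdCoeff q e : ℂ) * f e‖ ≤
      B * ((q.divisors.card : ℝ) ^ 3 * (q : ℝ) ^ (-(1 / 2) : ℝ)) := by
  have hq0 : (0 : ℝ) < q := by exact_mod_cast hq
  have hB : 0 ≤ B := by
    have := (norm_nonneg _).trans (hf 1 (by simp [hq.ne']))
    simpa using this
  calc ‖∑ e ∈ q.divisors, (gcdCoeff q e : ℂ) * f e‖
      ≤ ∑ e ∈ q.divisors, ‖(gcdCoeff q e : ℂ) * f e‖ := norm_sum_le _ _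
    _ ≤ ∑ e ∈ q.divisors, B * ((q.divisors.card : ℝ) ^ 2 * (q : ℝ) ^ (-(1 / 2) : ℝ)) := by
        refine Finset.sum_le_sum fun e he => ?_
        have hd := Nat.dvd_of_mem_divisors he
        have he0 : (0 : ℝ) < e := by exact_mod_cast Nat.pos_of_dvd_of_pos hd hq
        have heq : (e : ℝ) ≤ q := by exact_mod_cast Nat.le_of_dvd hq hd
        have h1 : (e : ℝ) * (e : ℝ) ^ (-(1 / 2) : ℝ) = (e : ℝ) ^ (1 / 2 : ℝ) := by
          rw [← Real.rpow_one_add' he0.le (by norm_num)]; norm_num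
        have h2 : (q : ℝ) ^ (1 / 2 : ℝ) / q = (q : ℝ) ^ (-(1 / 2) : ℝ) := by
          rw [← Real.rpow_sub_one hq0.ne']; norm_num
        rw [norm_mul, Complex.norm_real, Real.norm_eq_abs]
        calc |gcdCoeff q e| * ‖f e‖
            ≤ ((q.divisors.card : ℝ) ^ 2 * (e / q)) * (B * (e : ℝ) ^ (-(1 / 2) : ℝ)) :=
              mul_le_mul (abs_gcdCoeff_le hq hd) (hf e he) (norm_nonneg _) (by positivity)
          _ = B * ((q.divisors.card : ℝ) ^ 2 * ((e * (e : ℝ) ^ (-(1 / 2) : ℝ)) / q)) := by ring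
          _ ≤ B * ((q.divisors.card : ℝ) ^ 2 * ((q : ℝ) ^ (1 / 2 : ℝ) / q)) := by
              rw [h1]; gcongr
          _ = _ := by rw [h2]
    _ = _ := by rw [Finset.sum_const, nsmul_eq_mul]; ring

theorem eventually_smoothness_bound_le {δ : ℝ} (hδ : 0 < δ) {c : ℝ} (hc : 0 < c) :
    ∀ᶠ x : ℝ in atTop, ∀ y : ℝ, y ≤ Real.exp (Real.log x ^ (1 / 2 - δ)) →
      12 ≤ c * x ^ δ ∧ (y + 1) ^ 6 ≤ c * x ^ δ ∨ y < 0 := by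
  have h1 : ∀ᶠ x : ℝ in atTop, max 1 (max (7 / δ) (Real.log (64 / c))) ≤ √(Real.log x) :=
    (Real.tendsto_sqrt_atTop.comp Real.tendsto_log_atTop).eventually_ge_atTop _
  filter_upwards [h1, eventually_gt_atTop 1] with x hx hx1 y hy
  rcases lt_or_ge y 0 with hy0 | hy0
  · exact Or.inr hy0
  left
  have hx0 : 0 < x := by linarith
  have hL0 : 0 < Real.log x := Real.log_pos hx1
  set u := √(Real.log x) with hu
  have huu : u ^ 2 = Real.log x := Real.sq_sqrt hL0.le
  have hu1 : 1 ≤ u := (le_max_left _ _).trans hx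
  have hu2 : 7 / δ ≤ u := ((le_max_left _ _).trans (le_max_right _ _)).trans hx
  have hu3 : Real.log (64 / c) ≤ u := ((le_max_right _ _).trans (le_max_right _ _)).trans hx
  have hL1 : 1 ≤ Real.log x := by rw [← huu]; exact one_le_pow₀ hu1
  have hy2 : y ≤ Real.exp u := by
    refine hy.trans (Real.exp_le_exp.2 ?_)
    rw [hu, Real.sqrt_eq_rpow]
    exact Real.rpow_le_rpow_of_exponent_le hL1 (by linarith)
  have hkey : 64 * Real.exp (6 * u) ≤ c * x ^ δ := by
    have h2 : 7 ≤ δ * u := by rwa [div_le_iff₀' hδ] at hu2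
    have h3 : Real.log (64 / c) + 6 * u ≤ Real.log x * δ := by
      rw [← huu]; nlinarith
    have h4 := Real.exp_le_exp.2 h3
    rw [Real.exp_add, Real.exp_log (by positivity), ← Real.rpow_def_of_pos hx0,
      div_mul_eq_mul_div, div_le_iff₀ hc] at h4
    linarith
  have hexp : 1 ≤ Real.exp u := Real.one_le_exp (by linarith)
  have hpow : Real.exp (6 * u) = Real.exp u ^ 6 := by rw [← Real.exp_nat_mul]; norm_num
  rw [hpow] at hkey
  constructor
  · have : 1 ≤ Real.exp u ^ 6 := one_le_pow₀ hexp
    linarith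
  · calc (y + 1) ^ 6 ≤ (2 * Real.exp u) ^ 6 := by gcongr; linarith
      _ = 64 * Real.exp u ^ 6 := by ring
      _ ≤ _ := hkey

theorem rpow_bound_of_le_sqrt_div {x l η ε : ℝ} {q : ℕ} (hx : 1 ≤ x) (hq : 0 < q) (hl : 1 ≤ l)
    (hlq : l ≤ √x / q) (hε : 0 < ε) (hη : 2 * η ≤ ε / 2) :
    l ^ (1 / 2 + ε) * x ^ (1 / 2 + 2 * η) ≤ x ^ (3 / 4 + ε) * (q : ℝ) ^ (-(1 / 2) : ℝ) := by
  have hx0 : 0 < x := by linarith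
  have hq1 : (1 : ℝ) ≤ q := by exact_mod_cast hq
  have hq0 : (0 : ℝ) < q := by linarith
  have h1 : l ^ (1 / 2 + ε) ≤ x ^ (1 / 4 + ε / 2) * (q : ℝ) ^ (-(1 / 2) : ℝ) := by
    calc l ^ (1 / 2 + ε) ≤ (√x / q) ^ (1 / 2 + ε) := by gcongr
      _ = x ^ (1 / 4 + ε / 2) * (q : ℝ) ^ (-(1 / 2 + ε)) := by
          rw [Real.div_rpow (Real.sqrt_nonneg _) hq0.le, Real.sqrt_eq_rpow, ← Real.rpow_mul hx0.le,
            Real.rpow_neg hq0.le, div_eq_mul_inv]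
          ring_nf
      _ ≤ _ := by
          gcongr ?_ * ?_
          exact Real.rpow_le_rpow_of_exponent_le hq1 (by linarith)
  calc _ ≤ (x ^ (1 / 4 + ε / 2) * (q : ℝ) ^ (-(1 / 2) : ℝ)) * x ^ (1 / 2 + ε / 2) := by
        gcongr
    _ = (x ^ (1 / 4 + ε / 2) * x ^ (1 / 2 + ε / 2)) * (q : ℝ) ^ (-(1 / 2) : ℝ) := by ring
    _ = _ := by rw [← Real.rpow_add hx0]; ring_nf

theorem local_main_term_minor_arc_bound (hGRH : GRH)
    (Φ : ℝ → ℝ) (hsmooth : ContDiff ℝ (⊤ : ℕ∞) Φ) (hcompact : HasCompactSupport Φ)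
    (hsupp : tsupport Φ ⊆ Set.Ioi 0) (δ ε : ℝ) (hδ : 0 < δ) (hε : 0 < ε) :
    ∃ C > (0 : ℝ), ∃ x₀ : ℝ, ∀ x ≥ x₀, ∀ y : ℝ,
      (Real.log x) ^ (2 + δ) ≤ y → y ≤ Real.exp ((Real.log x) ^ ((1 : ℝ) / 2 - δ)) →
      ∀ q₀ : ℕ, 0 < q₀ → (∀ p : ℕ, p.Prime → p ∣ q₀ → (p : ℝ) ≤ y) →
      ∀ γ : ℝ, x ^ (δ - 1) ≤ |γ| → |γ| ≤ 1 / ((q₀ : ℝ) * Real.sqrt x) →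
        ‖Mterm x y Φ q₀ γ‖ ≤ C * x ^ ((3 : ℝ) / 4 + ε) * (q₀ : ℝ) ^ (-(3 : ℝ) / 4 + ε) := by
  obtain ⟨a, b, ha, hab, hK⟩ := exists_Ioo_of_isCompact hcompact hsupp
  obtain ⟨k, hk⟩ := exists_nat_ge (1 / δ)
  have hη : 0 < min (1 / 4) (ε / 4) := lt_min (by norm_num) (by linarith)
  obtain ⟨C, hC, hmain⟩ := exists_norm_tsum_smoothNumbers_twist_le
    (fun s hs _ => hGRH.riemannZeta_ne_zero hs) ha hab hsmooth hK hη (min_le_left _ _) hε k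
  set η := min (1 / 4) (ε / 4) with hηdef
  obtain ⟨T, hT, htau⟩ := exists_card_divisors_le (k := 12) (by norm_num)
  have hpia : 0 < Real.pi * a := by positivity
  obtain ⟨x₀, hx₀⟩ := eventually_atTop.1
    ((eventually_smoothness_bound_le hδ hpia).and (eventually_ge_atTop 1))
  refine ⟨C * T ^ 3 + 1, by positivity, x₀, fun x hx y hy₁ hy₂ q hq hqy γ hγ₁ hγ₂ => ?_⟩
  obtain ⟨hbd, hx1⟩ := hx₀ x hx
  have hx0 : 0 < x := by linarith
  have hy0 : 0 ≤ y := (Real.rpow_nonneg (Real.log_nonneg hx1) _).trans hy₁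
  obtain ⟨h12, hy6⟩ := (hbd y hy₂).resolve_right hy0.not_gt
  have hq1 : (1 : ℝ) ≤ q := by exact_mod_cast hq
  have hq0 : (0 : ℝ) < q := by linarith
  set l : ℝ := |γ| * x with hldef
  have hxl : x ^ δ ≤ l := by
    calc x ^ δ = x ^ (δ - 1) * x := by rw [Real.rpow_sub_one hx0.ne']; field_simp
      _ ≤ |γ| * x := by gcongr
  have hl1 : 1 ≤ l := (Real.one_le_rpow hx1 hδ.le).trans hxl
  have hsq : 0 < √x := Real.sqrt_pos.2 hx0
  have hlq : l ≤ √x / q := by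
    calc l ≤ 1 / (q * √x) * x := mul_le_mul_of_nonneg_right hγ₂ hx0.le
      _ = _ := by
        conv_lhs => rw [← Real.mul_self_sqrt hx0.le]
        have : √(√x * √x) = √x := by rw [Real.mul_self_sqrt hx0.le]
        rw [this]
        field_simp
  have hqx : (q : ℝ) ≤ x := by
    have h1 : (q : ℝ) ≤ √x := by
      have := (le_div_iff₀ hq0).1 hlq
      nlinarith
    refine h1.trans ?_
    rw [Real.sqrt_le_left hx0.le]
    nlinarith
  have hxk : x ≤ l ^ k := by
    have h1 : 1 ≤ δ * k := by rwa [div_le_iff₀' hδ] at hk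
    calc x = x ^ (1 : ℝ) := (Real.rpow_one x).symm
      _ ≤ x ^ (δ * k) := Real.rpow_le_rpow_of_exponent_le hx1 h1
      _ = (x ^ δ) ^ k := by rw [Real.rpow_mul hx0.le, Real.rpow_natCast]
      _ ≤ l ^ k := by gcongr
  have hN : (((⌊y⌋₊ + 1 : ℕ) : ℝ)) ^ 6 ≤ Real.pi * a * l := by
    calc (((⌊y⌋₊ + 1 : ℕ) : ℝ)) ^ 6 ≤ (y + 1) ^ 6 := by
          push_cast; gcongr; exact Nat.floor_le hy0
      _ ≤ Real.pi * a * x ^ δ := hy6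
      _ ≤ _ := by gcongr
  have hqs : q ∈ (⌊y⌋₊ + 1).smoothNumbers := (mem_smoothNumbers_floor_iff hy0 q).2 ⟨hq, hqy⟩
  have hfin : (Function.support fun n : ℕ => twist Φ l (x⁻¹ * n)).Finite := by
    refine (Set.finite_Iic ⌊x * b⌋₊).subset fun n hn => ?_
    by_contra h
    refine hn (twist_eq_zero hK l fun h' => h (Nat.le_floor ?_))
    exact ((inv_mul_lt_iff₀ hx0).1 h'.2).le
  have hγl : ‖Mterm x y Φ q γ‖ = ‖Mterm x y Φ q (-(l / x))‖ := by
    have : l / x = |γ| := by rw [hldef]; field_simp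
    rw [this]
    rcases abs_choice γ with h | h <;> rw [h]
    · rw [norm_Mterm_neg]
    · rw [neg_neg]
  rw [hγl, Mterm_neg_eq hx0 hy0, tsum_smoothNumbers_gcdWeight_eq hqs hfin]
  have hsum := norm_sum_gcdCoeff_mul_le (q := q) hq
    (f := fun e => ∑' m : ℕ, (⌊y⌋₊ + 1).smoothNumbers.indicator (fun _ => 1) m *
      twist Φ l (x⁻¹ * ((e * m : ℕ) : ℝ)))
    (B := C * (l ^ (1 / 2 + ε) * x ^ (1 / 2 + 2 * η))) fun e he => ?_
  · refine hsum.trans ?_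
    have h1 := rpow_bound_of_le_sqrt_div hx1 hq hl1 hlq hε
      (η := η) (by have := min_le_right (1 / 4) (ε / 4); linarith)
    have h2 : (q.divisors.card : ℝ) ^ 3 ≤ T ^ 3 * (q : ℝ) ^ (1 / 4 : ℝ) := by
      calc (q.divisors.card : ℝ) ^ 3 ≤ (T * (q : ℝ) ^ (1 / (12 : ℕ) : ℝ)) ^ 3 := by
            gcongr; exact htau q hq
        _ = _ := by
            rw [mul_pow, ← Real.rpow_mul_natCast hq0.le]
            norm_num
    have h3 : (q : ℝ) ^ (-(1 / 2) : ℝ) * ((q : ℝ) ^ (1 / 4 : ℝ) * (q : ℝ) ^ (-(1 / 2) : ℝ)) ≤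
        (q : ℝ) ^ (-(3 : ℝ) / 4 + ε) := by
      rw [← Real.rpow_add hq0, ← Real.rpow_add hq0]
      exact Real.rpow_le_rpow_of_exponent_le hq1 (by linarith)
    calc _ ≤ C * (x ^ (3 / 4 + ε) * (q : ℝ) ^ (-(1 / 2) : ℝ)) *
          (T ^ 3 * (q : ℝ) ^ (1 / 4 : ℝ) * (q : ℝ) ^ (-(1 / 2) : ℝ)) := by gcongr
      _ = C * T ^ 3 * x ^ (3 / 4 + ε) * ((q : ℝ) ^ (-(1 / 2) : ℝ) *
          ((q : ℝ) ^ (1 / 4 : ℝ) * (q : ℝ) ^ (-(1 / 2) : ℝ))) := by ring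
      _ ≤ (C * T ^ 3 + 1) * x ^ (3 / 4 + ε) * (q : ℝ) ^ (-(3 : ℝ) / 4 + ε) := by
          gcongr; linarith
  · have hd := Nat.dvd_of_mem_divisors he
    have he1 : (1 : ℝ) ≤ e := by exact_mod_cast Nat.pos_of_dvd_of_pos hd hq
    have he0 : (0 : ℝ) < e := by linarith
    have heq : (e : ℝ) ≤ q := by exact_mod_cast Nat.le_of_dvd hq hd
    have h1 := hmain l (x / e) (⌊y⌋₊ + 1) hl1
      (h12.trans (by gcongr)) (Nat.succ_pos _) hN ((one_le_div he0).2 (heq.trans hqx))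
      ((div_le_self hx0.le he1).trans hxk)
    have e1 : ∀ m : ℕ, x⁻¹ * ((e * m : ℕ) : ℝ) = (x / e)⁻¹ * m := fun m => by
      push_cast; field_simp
    simp_rw [e1]
    refine h1.trans ?_
    have h2 : (x / e) ^ (1 / 2 + 2 * η) ≤ x ^ (1 / 2 + 2 * η) * (e : ℝ) ^ (-(1 / 2) : ℝ) := by
      rw [Real.div_rpow hx0.le he0.le, div_eq_mul_inv, ← Real.rpow_neg he0.le]
      gcongr ?_ * ?_
      exact Real.rpow_le_rpow_of_exponent_le he1 (by linarith)
    calc _ ≤ C * (l ^ (1 / 2 + ε) * (x ^ (1 / 2 + 2 * η) * (e : ℝ) ^ (-(1 / 2) : ℝ))) := by gcongr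
      _ = _ := by ring
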